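/- arXiv:2305.00612 — 2 statements merged into one kernel-verified Lean document; each statement's English description precedes it below -/
import Mathlib

section
/- Let d ≥ 2 and let u be harmonic in B_1 ⊂ ℝ^d and not identically zero. Then the Almgren frequency F(r) = r ∫_{B_r} |∇u|² dx / ∫_{∂B_r} |u|² dH^{d−1} is a monotonically nondecreasing function of r on (0,1). -/
open MeasureTheory Topology Filter Metric Set ENNReal

noncomputable section

/-- The Laplacian of `u : ℝ^d → ℝ` at `x`. -/
def lap {d : ℕ} (u : EuclideanSpace ℝ (Fin d) → ℝ) (x : EuclideanSpace ℝ (Fin d)) : ℝ :=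
  ∑ i : Fin d, fderiv ℝ (fun y => fderiv ℝ u y (EuclideanSpace.single i 1)) x
    (EuclideanSpace.single i 1)

/-- `u` is harmonic on `s`: twice continuously differentiable with vanishing Laplacian. -/
def HarmonicOn {d : ℕ} (u : EuclideanSpace ℝ (Fin d) → ℝ) (s : Set (EuclideanSpace ℝ (Fin d))) :
    Prop :=
  ContDiffOn ℝ 2 u s ∧ ∀ x ∈ s, lap u x = 0

/-- The Almgren frequency `F(r) = r ∫_{B_r} |∇u|² dx / ∫_{∂B_r} |u|² dH^{d-1}`. -/
def frequency {d : ℕ} (u : EuclideanSpace ℝ (Fin d) → ℝ) (r : ℝ) : ℝ :=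
  r * (∫ x in ball (0 : EuclideanSpace ℝ (Fin d)) r, ‖gradient u x‖ ^ 2) /
    ∫ x in sphere (0 : EuclideanSpace ℝ (Fin d)) r, (u x) ^ 2 ∂μH[((d : ℝ) - 1)]


lemma unif_closed_le {X : Type*} [MetricSpace X] [CompactSpace X] [MeasurableSpace X] [BorelSpace X]
    (μ ν : Measure X) [IsFiniteMeasure μ] [IsFiniteMeasure ν] (g h : ℝ → ℝ≥0∞)
    (hμ : ∀ x r, μ (ball x r) = g r) (hν : ∀ x r, ν (ball x r) = h r)
    (A : Set X) (_hA : IsClosed A) (r : ℝ) :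
    h r * μ A ≤ g r * ν (thickening r A) := by
  have hm : MeasurableSet {p : X × X | dist p.1 p.2 < r} :=
    (isOpen_lt (by fun_prop) (by fun_prop)).measurableSet
  have hmK : Measurable (fun p : X × X => ({p : X × X | dist p.1 p.2 < r}).indicator (1 : X × X → ℝ≥0∞) p) :=
    measurable_one.indicator hm
  have e1 : ∀ x : X, ∫⁻ y, ({p : X × X | dist p.1 p.2 < r}).indicator (1 : X × X → ℝ≥0∞) (x, y) ∂ν = h r := by
    intro x
    rw [← hν x r, ← lintegral_indicator_one measurableSet_ball]
    apply lintegral_congr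
    intro y
    simp [indicator, dist_comm]
  have e2 : ∀ y : X, ∫⁻ x in A, ({p : X × X | dist p.1 p.2 < r}).indicator (1 : X × X → ℝ≥0∞) (x, y) ∂μ = μ (ball y r ∩ A) := by
    intro y
    rw [← Measure.restrict_apply measurableSet_ball, ← lintegral_indicator_one measurableSet_ball]
    apply lintegral_congr
    intro x
    simp [indicator]
  calc h r * μ A = ∫⁻ x in A, ∫⁻ y, ({p : X × X | dist p.1 p.2 < r}).indicator (1 : X × X → ℝ≥0∞) (x, y) ∂ν ∂μ := by
        simp_rw [e1]; simp
    _ = ∫⁻ y, μ (ball y r ∩ A) ∂ν := by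
        rw [lintegral_lintegral_swap hmK.aemeasurable]
        simp_rw [e2]
    _ ≤ ∫⁻ y, (thickening r A).indicator (fun _ => g r) y ∂ν := by
        apply lintegral_mono
        intro y
        by_cases hy : y ∈ thickening r A
        · simp only [indicator_of_mem hy]
          rw [← hμ y r]; exact measure_mono inter_subset_left
        · have : ball y r ∩ A = ∅ := by
            ext z
            simp only [mem_inter_iff, mem_empty_iff_false, iff_false, not_and]
            intro h1 h2
            exact hy (mem_thickening_iff.2 ⟨z, h2, by simpa [dist_comm] using h1⟩)
          simp [this]
    _ = g r * ν (thickening r A) := by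
        rw [lintegral_indicator isOpen_thickening.measurableSet]; simp

lemma unif_prop {X : Type*} [MetricSpace X] [CompactSpace X] [Nonempty X] [MeasurableSpace X] [BorelSpace X]
    (μ ν : Measure X) [IsFiniteMeasure μ] [IsFiniteMeasure ν] (g h : ℝ → ℝ≥0∞)
    (hμ : ∀ x r, μ (ball x r) = g r) (hν : ∀ x r, ν (ball x r) = h r)
    (hpos : ∀ r, 0 < r → h r ≠ 0) :
    ∃ c : ℝ≥0∞, c ≠ ∞ ∧ μ = c • ν := by
  obtain ⟨x0⟩ := ‹Nonempty X›
  have hfin : ∀ r, h r ≠ ∞ := fun r => by rw [← hν x0 r]; exact measure_ne_top _ _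
  have gfin : ∀ r, g r ≠ ∞ := fun r => by rw [← hμ x0 r]; exact measure_ne_top _ _
  have hν0 : ν univ ≠ 0 := by
    intro h0
    exact hpos 1 one_pos (by rw [← hν x0 1]; exact measure_mono_null (subset_univ _) h0)
  -- exact total-mass identity
  have tot : ∀ r, 0 < r → h r * μ univ = g r * ν univ := by
    intro r hr
    have ht : thickening r (univ : Set X) = univ := by
      apply eq_univ_of_univ_subset; exact self_subset_thickening hr _
    apply le_antisymm
    · simpa [ht] using unif_closed_le μ ν g h hμ hν univ isClosed_univ r
    · simpa [ht] using unif_closed_le ν μ h g hν hμ univ isClosed_univ r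
  set c := μ univ / ν univ with hc
  have cfin : c ≠ ∞ := ENNReal.div_ne_top (measure_ne_top _ _) hν0
  have cg : ∀ r, 0 < r → g r = c * h r := by
    intro r hr
    have := tot r hr
    rw [hc, mul_comm, ← mul_div_assoc, this, ENNReal.mul_div_cancel_right hν0 (measure_ne_top _ _)]
  refine ⟨c, cfin, ?_⟩
  have lim : ∀ (ρ : Measure X) [IsFiniteMeasure ρ] (A : Set X), IsClosed A →
      Tendsto (fun r => ρ (thickening r A)) (𝓝[>] 0) (𝓝 (ρ A)) := by
    intro ρ _ A hA
    exact tendsto_measure_thickening_of_isClosed ⟨1, one_pos, measure_ne_top _ _⟩ hA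
  have key : ∀ A : Set X, IsClosed A → μ A = c * ν A := by
    intro A hA
    apply le_antisymm
    · refine ge_of_tendsto (ENNReal.Tendsto.const_mul (lim ν A hA) (Or.inr cfin)) ?_
      filter_upwards [self_mem_nhdsWithin] with r (hr : 0 < r)
      have h1 := unif_closed_le μ ν g h hμ hν A hA r
      rw [cg r hr, mul_comm c, mul_assoc] at h1
      exact (ENNReal.mul_le_mul_iff_right (hpos r hr) (hfin r)).1 h1
    · refine ge_of_tendsto (lim μ A hA) ?_
      filter_upwards [self_mem_nhdsWithin] with r (hr : 0 < r)
      have h1 := unif_closed_le ν μ h g hν hμ A hA r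
      rw [cg r hr, mul_comm c, mul_assoc] at h1
      exact (ENNReal.mul_le_mul_iff_right (hpos r hr) (hfin r)).1 h1
  refine ext_of_generate_finite _ (BorelSpace.measurable_eq.trans borel_eq_generateFrom_isClosed) isPiSystem_isClosed ?_ ?_
  · intro A hA; simpa using key A hA
  · simpa using key univ isClosed_univ

lemma sphere_move {d : ℕ} (x y : sphere (0 : EuclideanSpace ℝ (Fin d)) 1) :
    ∃ L : EuclideanSpace ℝ (Fin d) ≃ₗᵢ[ℝ] EuclideanSpace ℝ (Fin d), L x = y := by
  refine ⟨Submodule.reflection (Submodule.span ℝ {(x : EuclideanSpace ℝ (Fin d)) - y})ᗮ, ?_⟩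
  exact Submodule.reflection_sub (by simp [norm_eq_of_mem_sphere])

def sphIso {d : ℕ} (L : EuclideanSpace ℝ (Fin d) ≃ₗᵢ[ℝ] EuclideanSpace ℝ (Fin d)) :
    sphere (0 : EuclideanSpace ℝ (Fin d)) 1 ≃ᵢ sphere (0 : EuclideanSpace ℝ (Fin d)) 1 where
  toFun z := ⟨L z, by simp⟩
  invFun z := ⟨L.symm z, by simp⟩
  left_inv z := by simp
  right_inv z := by simp
  isometry_toFun := by
    intro a b
    simp [Subtype.edist_eq]

lemma hausdorff_ball {d : ℕ} (s : ℝ) (x y : sphere (0 : EuclideanSpace ℝ (Fin d)) 1) (r : ℝ) :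
    (μH[s] : Measure (sphere (0 : EuclideanSpace ℝ (Fin d)) 1)) (ball x r) = μH[s] (ball y r) := by
  obtain ⟨L, hL⟩ := sphere_move x y
  rw [← (sphIso L).hausdorffMeasure_image, IsometryEquiv.image_ball]
  congr 2
  exact Subtype.ext hL

open scoped Pointwise in
lemma toSphere_ball {d : ℕ} (x y : sphere (0 : EuclideanSpace ℝ (Fin d)) 1) (r : ℝ) :
    (volume : Measure (EuclideanSpace ℝ (Fin d))).toSphere (ball x r) =
      (volume : Measure (EuclideanSpace ℝ (Fin d))).toSphere (ball y r) := by
  obtain ⟨L, hL⟩ := sphere_move x y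
  rw [Measure.toSphere_apply' _ measurableSet_ball, Measure.toSphere_apply' _ measurableSet_ball]
  congr 1
  have hb : ball y r = (sphIso L) '' (ball x r) := by
    rw [IsometryEquiv.image_ball]
    congr 1
    exact Subtype.ext hL.symm
  rw [hb]
  have : Ioo (0:ℝ) 1 • (Subtype.val '' (sphIso L '' ball x r)) =
      L '' (Ioo (0:ℝ) 1 • (Subtype.val '' ball x r)) := by
    ext z
    simp only [Set.mem_smul, mem_image]
    constructor
    · rintro ⟨t, ht, _, ⟨_, ⟨w, hw, rfl⟩, rfl⟩, rfl⟩
      exact ⟨t • (w : EuclideanSpace ℝ (Fin d)), ⟨t, ht, w, ⟨w, hw, rfl⟩, rfl⟩, by rw [map_smul]; rfl⟩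
    · rintro ⟨_, ⟨t, ht, _, ⟨w, hw, rfl⟩, rfl⟩, rfl⟩
      exact ⟨t, ht, _, ⟨_, ⟨w, hw, rfl⟩, rfl⟩, by rw [map_smul]; rfl⟩
  rw [this]
  have h2 : L '' (Ioo (0:ℝ) 1 • (Subtype.val '' ball x r)) =
    L.symm ⁻¹' (Ioo (0:ℝ) 1 • (Subtype.val '' ball x r)) := L.toEquiv.image_eq_preimage_symm _
  rw [h2, L.symm.measurePreserving.measure_preimage_emb L.symm.toHomeomorph.measurableEmbedding]

lemma hausdorff_sphere_one {d : ℕ} (hd : 2 ≤ d) (s : ℝ) :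
    ∃ c : ℝ, 0 ≤ c ∧ ∀ f : sphere (0 : EuclideanSpace ℝ (Fin d)) 1 → ℝ, Continuous f →
      (∀ x, 0 ≤ f x) →
      ∫ x, f x ∂μH[s] = c * ∫ x, f x ∂(volume : Measure (EuclideanSpace ℝ (Fin d))).toSphere := by
  have : Nonempty (Fin d) := ⟨⟨0, by omega⟩⟩
  have : Nontrivial (EuclideanSpace ℝ (Fin d)) := inferInstance
  obtain ⟨x0⟩ : Nonempty (sphere (0 : EuclideanSpace ℝ (Fin d)) 1) :=
    (NormedSpace.sphere_nonempty.2 zero_le_one).to_subtype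
  by_cases hfin : (μH[s] : Measure (sphere (0 : EuclideanSpace ℝ (Fin d)) 1)) univ = ∞
  · refine ⟨0, le_rfl, fun f hf hf0 => ?_⟩
    rw [zero_mul]
    by_cases h0 : ∀ x, f x = 0
    · simp [h0]
    push Not at h0
    obtain ⟨x, hx⟩ := h0
    have hx : 0 < f x := lt_of_le_of_ne (hf0 x) hx.symm
    apply integral_undef
    intro hint
    have h1 := hint.measure_norm_ge_lt_top (half_pos hx)
    obtain ⟨ε, hε, hball⟩ := Metric.mem_nhds_iff.1
      (hf.continuousAt.preimage_mem_nhds (Ioi_mem_nhds (half_lt_self hx)))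
    have h2 : (μH[s] : Measure (sphere (0 : EuclideanSpace ℝ (Fin d)) 1)) (ball x ε) < ∞ := by
      refine lt_of_le_of_lt (measure_mono ?_) h1
      intro z hz
      have := hball hz
      simp only [mem_preimage, mem_Ioi] at this
      simp only [mem_ofPred_eq, Real.norm_eq_abs]
      exact this.le.trans (le_abs_self _)
    have h3 : (μH[s] : Measure (sphere (0 : EuclideanSpace ℝ (Fin d)) 1)) univ < ∞ := by
      refine isCompact_univ.measure_lt_top_of_nhdsWithin ?_
      intro y _
      refine ⟨ball y ε, mem_nhdsWithin_of_mem_nhds (ball_mem_nhds y hε), ?_⟩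
      rw [hausdorff_ball s y x]; exact h2
    exact h3.ne hfin
  · have : IsFiniteMeasure (μH[s] : Measure (sphere (0 : EuclideanSpace ℝ (Fin d)) 1)) :=
      ⟨lt_top_iff_ne_top.2 hfin⟩
    have : Nonempty (sphere (0 : EuclideanSpace ℝ (Fin d)) 1) := ⟨x0⟩
    obtain ⟨c, hc, h⟩ := unif_prop (μH[s] : Measure (sphere (0 : EuclideanSpace ℝ (Fin d)) 1))
      (volume : Measure (EuclideanSpace ℝ (Fin d))).toSphere
      (fun r => μH[s] (ball x0 r)) (fun r => (volume : Measure (EuclideanSpace ℝ (Fin d))).toSphere (ball x0 r))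
      (fun x r => hausdorff_ball s x x0 r) (fun x r => toSphere_ball x x0 r)
      (fun r hr => (measure_ball_pos _ _ hr).ne')
    refine ⟨c.toReal, ENNReal.toReal_nonneg, fun f _ _ => ?_⟩
    rw [h, integral_smul_measure, smul_eq_mul]

/-- Spherical integral of `f` over the sphere of radius `r`, via `toSphere`. -/
def SI {d : ℕ} (f : EuclideanSpace ℝ (Fin d) → ℝ) (r : ℝ) : ℝ :=
  r ^ (d - 1) * ∫ θ : sphere (0 : EuclideanSpace ℝ (Fin d)) 1, f (r • (θ : EuclideanSpace ℝ (Fin d)))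
    ∂(volume : Measure (EuclideanSpace ℝ (Fin d))).toSphere

open scoped Pointwise in
lemma hausdorff_sphere {d : ℕ} (hd : 2 ≤ d) :
    ∃ c : ℝ, 0 ≤ c ∧ ∀ f : EuclideanSpace ℝ (Fin d) → ℝ, Continuous f →
      (∀ x, 0 ≤ f x) → ∀ r : ℝ, 0 < r →
      ∫ x in sphere (0 : EuclideanSpace ℝ (Fin d)) r, f x ∂μH[(d : ℝ) - 1] = c * SI f r := by
  obtain ⟨c, hc, h⟩ := hausdorff_sphere_one hd ((d:ℝ) - 1)
  refine ⟨c, hc, fun f hf hf0 r hr => ?_⟩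
  have hd1 : (0:ℝ) ≤ (d:ℝ) - 1 := by
    have : (2:ℝ) ≤ d := by exact_mod_cast hd
    linarith
  have e1 := h (fun θ => f (r • (θ : EuclideanSpace ℝ (Fin d)))) (by fun_prop) (fun _ => hf0 _)
  have e2 : ∫ θ : sphere (0 : EuclideanSpace ℝ (Fin d)) 1, f (r • (θ : EuclideanSpace ℝ (Fin d))) ∂μH[(d : ℝ) - 1]
      = ∫ x in sphere (0 : EuclideanSpace ℝ (Fin d)) 1, f (r • x) ∂μH[(d : ℝ) - 1] := by
    have := (isometry_subtype_coe (s := sphere (0 : EuclideanSpace ℝ (Fin d)) 1)).map_hausdorffMeasure (Or.inl hd1)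
    rw [Subtype.range_coe] at this
    rw [← this, (MeasurableEmbedding.subtype_coe isClosed_sphere.measurableSet).integral_map]
  have e3 : (μH[(d : ℝ) - 1] : Measure (EuclideanSpace ℝ (Fin d))).restrict (sphere 0 r) =
      ENNReal.ofReal (r ^ (d - 1)) •
      ((μH[(d : ℝ) - 1] : Measure (EuclideanSpace ℝ (Fin d))).restrict (sphere 0 1)).map (fun x => r • x) := by
    ext1 s hs
    have hm : Measurable (fun x : EuclideanSpace ℝ (Fin d) => r • x) := by fun_prop
    rw [Measure.restrict_apply hs, Measure.smul_apply, Measure.map_apply hm hs,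
      Measure.restrict_apply (hm hs)]
    have hset : s ∩ sphere 0 r = r • (((fun x : EuclideanSpace ℝ (Fin d) => r • x) ⁻¹' s) ∩ sphere 0 1) := by
      ext z
      rw [mem_smul_set_iff_inv_smul_mem₀ hr.ne']
      simp only [mem_inter_iff, mem_preimage, smul_inv_smul₀ hr.ne', mem_sphere_iff_norm, sub_zero,
        norm_smul, norm_inv, Real.norm_eq_abs, abs_of_pos hr]
      constructor
      · rintro ⟨a, b⟩; exact ⟨a, by rw [b]; field_simp⟩
      · rintro ⟨a, b⟩; refine ⟨a, ?_⟩; field_simp at b; exact b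
    rw [hset, Measure.hausdorffMeasure_smul₀ hd1 hr.ne', ENNReal.smul_def]
    congr 1
    have : ((d:ℝ) - 1) = ((d - 1 : ℕ) : ℝ) := by rw [Nat.cast_sub (by omega)]; simp
    rw [this, NNReal.rpow_natCast, ENNReal.ofReal, Real.toNNReal_pow hr.le]
    congr 2
    ext; simp [abs_of_pos hr, hr.le]
  have hme : MeasurableEmbedding (fun x : EuclideanSpace ℝ (Fin d) => r • x) :=
    (Homeomorph.smulOfNeZero r hr.ne').measurableEmbedding
  rw [e3, integral_smul_measure, hme.integral_map, ← e2, e1, SI, ENNReal.toReal_ofReal (by positivity)]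
  simp only [smul_eq_mul]
  ring

lemma polar {d : ℕ} (hd : 2 ≤ d) (f : EuclideanSpace ℝ (Fin d) → ℝ) (hf : Integrable f) :
    ∫ x, f x = ∫ r in Ioi (0:ℝ), SI f r := by
  have : Nonempty (Fin d) := ⟨⟨0, by omega⟩⟩
  have : Nontrivial (EuclideanSpace ℝ (Fin d)) := inferInstance
  have hfr : Module.finrank ℝ (EuclideanSpace ℝ (Fin d)) = d := by simp
  set σ := (volume : Measure (EuclideanSpace ℝ (Fin d))).toSphere with hσ
  have mp := (volume : Measure (EuclideanSpace ℝ (Fin d))).measurePreserving_homeomorphUnitSphereProd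
  rw [hfr] at mp
  let G : sphere (0 : EuclideanSpace ℝ (Fin d)) 1 × Ioi (0:ℝ) → ℝ := fun p => f (p.2.1 • p.1.1)
  have hG : ∀ x : ({0}ᶜ : Set (EuclideanSpace ℝ (Fin d))), G (homeomorphUnitSphereProd _ x) = f x := by
    intro x
    have hx : ‖(x : EuclideanSpace ℝ (Fin d))‖ ≠ 0 := norm_ne_zero_iff.2 x.2
    simp only [G, homeomorphUnitSphereProd_apply_snd_coe, homeomorphUnitSphereProd_apply_fst_coe]
    rw [smul_inv_smul₀ hx]
  have e1 : ∫ x, f x = ∫ p, G p ∂(σ.prod (Measure.volumeIoiPow (d - 1))) := by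
    rw [← mp.integral_comp (Homeomorph.measurableEmbedding _)]
    simp_rw [hG]
    rw [integral_subtype_comap (measurableSet_singleton _).compl f, restrict_compl_singleton]
  have hGi : Integrable G (σ.prod (Measure.volumeIoiPow (d - 1))) := by
    rw [← mp.integrable_comp_emb (Homeomorph.measurableEmbedding _)]
    have : G ∘ (homeomorphUnitSphereProd (EuclideanSpace ℝ (Fin d))) = f ∘ Subtype.val := by
      ext x; exact hG x
    rw [this, ← integrableOn_iff_comap_subtypeVal (measurableSet_singleton _).compl, IntegrableOn,
      restrict_compl_singleton]
    exact hf
  rw [e1, integral_prod_symm _ hGi]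
  simp only [Measure.volumeIoiPow, ENNReal.ofReal]
  rw [integral_withDensity_eq_integral_smul
    (by exact (measurable_subtype_coe.pow_const _).real_toNNReal)]
  rw [integral_subtype_comap measurableSet_Ioi
    (fun a : ℝ ↦ Real.toNNReal (a ^ (d - 1)) • ∫ θ, f (a • (θ : EuclideanSpace ℝ (Fin d))) ∂σ)]
  refine setIntegral_congr_fun measurableSet_Ioi fun x hx ↦ ?_
  simp only [SI]
  rw [NNReal.smul_def, Real.coe_toNNReal _ (pow_nonneg (le_of_lt hx) _), smul_eq_mul]

lemma SI_continuous {d : ℕ} {f : EuclideanSpace ℝ (Fin d) → ℝ} (hf : Continuous f) :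
    Continuous (SI f) := by
  unfold SI
  refine (continuous_id.pow _).mul ?_
  have := continuous_parametric_integral_of_continuous
    (μ := (volume : Measure (EuclideanSpace ℝ (Fin d))).toSphere)
    (f := fun (r : ℝ) (θ : sphere (0 : EuclideanSpace ℝ (Fin d)) 1) => f (r • (θ : EuclideanSpace ℝ (Fin d))))
    (by unfold Function.uncurry; fun_prop) isCompact_univ
  simpa using this

lemma SI_mul_norm {d : ℕ} (f : EuclideanSpace ℝ (Fin d) → ℝ) (h : ℝ → ℝ) (r : ℝ) (hr : 0 < r) :
    SI (fun x => h ‖x‖ * f x) r = h r * SI f r := by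
  unfold SI
  have : ∀ θ : sphere (0 : EuclideanSpace ℝ (Fin d)) 1,
      h ‖r • (θ : EuclideanSpace ℝ (Fin d))‖ * f (r • (θ : EuclideanSpace ℝ (Fin d))) =
      h r * f (r • (θ : EuclideanSpace ℝ (Fin d))) := by
    intro θ
    rw [norm_smul, norm_eq_of_mem_sphere, mul_one, Real.norm_eq_abs, abs_of_pos hr]
  simp_rw [this]
  rw [integral_const_mul]; ring

lemma ball_polar {d : ℕ} (hd : 2 ≤ d) {f : EuclideanSpace ℝ (Fin d) → ℝ} (hf : Continuous f)
    (r : ℝ) (hr : 0 < r) :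
    ∫ x in ball (0 : EuclideanSpace ℝ (Fin d)) r, f x = ∫ s in (0:ℝ)..r, SI f s := by
  have e : (ball (0 : EuclideanSpace ℝ (Fin d)) r).indicator f =
      fun x => (Iio r).indicator (fun _ => (1:ℝ)) ‖x‖ * f x := by
    ext x
    by_cases hx : ‖x‖ < r <;> simp [indicator, hx]
  have hi : Integrable ((ball (0 : EuclideanSpace ℝ (Fin d)) r).indicator f) := by
    rw [integrable_indicator_iff measurableSet_ball]
    exact (hf.continuousOn.integrableOn_compact (isCompact_closedBall 0 r)).mono_set ball_subset_closedBall
  rw [← integral_indicator measurableSet_ball, polar hd _ hi, e,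
    intervalIntegral.integral_of_le hr.le, integral_Ioc_eq_integral_Ioo,
    setIntegral_congr_fun measurableSet_Ioi (fun s hs => SI_mul_norm f _ s hs)]
  have : ∀ s, (Iio r).indicator (fun _ => (1:ℝ)) s * SI f s = (Iio r).indicator (SI f) s := by
    intro s; by_cases hs : s < r <;> simp [indicator, hs]
  simp_rw [this]
  rw [setIntegral_indicator measurableSet_Iio, Ioi_inter_Iio]

lemma div_scalar {d : ℕ} (hd : 2 ≤ d) {f : EuclideanSpace ℝ (Fin d) → ℝ} (hf : ContDiff ℝ 1 f)
    (i : Fin d) (r : ℝ) (hr : 0 < r) :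
    SI (fun x => f x * x i) r =
      r * ∫ s in (0:ℝ)..r, SI (fun x => fderiv ℝ f x (EuclideanSpace.single i 1)) s := by
  set f' : EuclideanSpace ℝ (Fin d) → ℝ := fun x => fderiv ℝ f x (EuclideanSpace.single i 1) with hf'
  have cf : Continuous f := hf.continuous
  have cf' : Continuous f' := by
    exact (hf.continuous_fderiv one_ne_zero).clm_apply continuous_const
  set P : ℝ → ℝ := fun r => ∫ s in (0:ℝ)..r, SI f' s with hP
  have hPd : ∀ s, HasDerivAt P (SI f' s) s := fun s =>
    (SI_continuous cf').integral_hasStrictDerivAt 0 s |>.hasDerivAt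
  have cP : Continuous P := continuous_iff_continuousAt.2 fun s => (hPd s).continuousAt
  have cfx : Continuous (fun x : EuclideanSpace ℝ (Fin d) => f x * x i) := by fun_prop
  have cS := SI_continuous cfx
  have cS' := SI_continuous cf'
  set Er : ℝ → ℝ := fun s => SI (fun x => f x * x i) s - s * P s with hEr
  have cE : Continuous Er := by fun_prop
  suffices h : EqOn Er 0 (Ioi 0) by
    have := h (mem_Ioi.2 hr)
    simp only [hEr, Pi.zero_apply] at this
    linarith
  refine Measure.eqOn_open_of_ae_eq (μ := volume) ?_ isOpen_Ioi cE.continuousOn continuousOn_const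
  rw [Filter.EventuallyEq, ae_restrict_iff' measurableSet_Ioi]
  refine isOpen_Ioi.ae_eq_zero_of_integral_contDiff_smul_eq_zero
    (cE.locallyIntegrable.locallyIntegrableOn _) ?_
  intro g hg hgc hgs
  have cg : Continuous g := hg.continuous
  have hg0 : ∀ s, s ≤ 0 → g s = 0 := by
    intro s hs
    by_contra h
    exact absurd (hgs (subset_tsupport _ h)) (by simpa using hs)
  obtain ⟨R, hR, hgR⟩ : ∃ R, 0 < R ∧ ∀ s, R ≤ s → g s = 0 := by
    obtain ⟨R, hR⟩ := hgc.isCompact.isBounded.subset_closedBall 0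
    refine ⟨max R 0 + 1, by positivity, fun s hs => ?_⟩
    by_contra h
    have := hR (subset_tsupport _ h)
    rw [mem_closedBall, dist_zero_right, Real.norm_eq_abs] at this
    have := (le_abs_self s).trans this
    have := le_max_left R 0
    linarith
  -- the cutoff
  set k : ℝ → ℝ := fun t => g (Real.sqrt t) with hk
  have ck : Continuous k := by fun_prop
  set ψ : ℝ → ℝ := fun t => ∫ τ in t..(R^2), k τ with hψ
  have hψd : ∀ t, HasDerivAt ψ (-k t) t := fun t =>
    intervalIntegral.integral_hasDerivAt_left (ck.intervalIntegrable _ _)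
      (ck.stronglyMeasurableAtFilter _ _) ck.continuousAt
  have cψ : Continuous ψ := continuous_iff_continuousAt.2 fun s => (hψd s).continuousAt
  have hψ0 : ∀ t, R^2 ≤ t → ψ t = 0 := by
    intro t ht
    simp only [hψ]
    rw [intervalIntegral.integral_congr (g := fun _ => (0:ℝ))]
    · simp
    · intro τ hτ
      rw [uIcc_of_ge ht] at hτ
      exact hgR _ (Real.le_sqrt_of_sq_le hτ.1)
  set Φ : EuclideanSpace ℝ (Fin d) → ℝ := fun x => ψ (‖x‖^2) with hΦ
  have hΦd : ∀ x, HasFDerivAt Φ ((-k (‖x‖^2)) • (2 • (innerSL ℝ x))) x := by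
    intro x
    exact (hψd (‖x‖^2)).comp_hasFDerivAt x (hasStrictFDerivAt_norm_sq x).hasFDerivAt
  have hΦe : ∀ x, fderiv ℝ Φ x (EuclideanSpace.single i 1) = - (2 * g ‖x‖ * x i) := by
    intro x
    rw [(hΦd x).fderiv]
    simp [hk, EuclideanSpace.inner_single_right]
    ring
  have cΦ : Continuous Φ := by fun_prop
  have hsupp : ∀ (h : EuclideanSpace ℝ (Fin d) → ℝ), (∀ x, R ≤ ‖x‖ → h x = 0) → HasCompactSupport h := by
    intro h hh
    refine HasCompactSupport.of_support_subset_isCompact (isCompact_closedBall 0 R) ?_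
    intro x hx
    rw [mem_closedBall_zero_iff]
    by_contra hc
    exact hx (hh x (by linarith))
  have hΦ0 : ∀ x, R ≤ ‖x‖ → Φ x = 0 := fun x hx => hψ0 _ (by gcongr)
  have hint : ∀ h : EuclideanSpace ℝ (Fin d) → ℝ, Continuous h → (∀ x, R ≤ ‖x‖ → h x = 0) → Integrable h :=
    fun h c z => c.integrable_of_hasCompactSupport (hsupp h z)
  have I1 : Integrable (fun x => Φ x * f' x) := hint _ (by fun_prop) (fun x hx => by simp [hΦ0 x hx])
  have I2 : Integrable (fun x : EuclideanSpace ℝ (Fin d) => 2 * g ‖x‖ * (f x * x i)) :=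
    hint _ (by fun_prop) (fun x hx => by simp [hgR _ hx])
  have I3 : Integrable (fun x => Φ x * f x) := hint _ (by fun_prop) (fun x hx => by simp [hΦ0 x hx])
  have ibp : ∫ x, Φ x * f' x = ∫ x : EuclideanSpace ℝ (Fin d), 2 * g ‖x‖ * (f x * x i) := by
    have h1 : ∀ x, fderiv ℝ Φ x (EuclideanSpace.single i 1) * f x = - (2 * g ‖x‖ * (f x * x i)) := by
      intro x; rw [hΦe]; ring
    have := integral_mul_fderiv_eq_neg_fderiv_mul_of_integrable (μ := volume) (f := Φ) (g := f)
      (v := EuclideanSpace.single i (1:ℝ)) (by simp_rw [h1]; exact I2.neg) I1 I3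
      (fun x _ => (hΦd x).differentiableAt) (fun x _ => (hf.differentiable one_ne_zero) x)
    rw [this]
    simp_rw [h1]
    rw [integral_neg, neg_neg]
  rw [polar hd _ I1, polar hd _ I2,
    setIntegral_congr_fun measurableSet_Ioi (fun s hs => SI_mul_norm f' (fun s => ψ (s^2)) s hs),
    setIntegral_congr_fun measurableSet_Ioi
      (fun s hs => SI_mul_norm (fun x => f x * x i) (fun s => 2 * g s) s hs)] at ibp
  have cut : ∀ F : ℝ → ℝ, (∀ s, R ≤ s → F s = 0) → ∫ s in Ioi 0, F s = ∫ s in (0:ℝ)..R, F s := by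
    intro F hF
    rw [intervalIntegral.integral_of_le hR.le]
    refine setIntegral_eq_of_subset_of_forall_sdiff_eq_zero measurableSet_Ioi Ioc_subset_Ioi_self ?_
    intro s hs
    refine hF s ?_
    have h1 : 0 < s := hs.1
    by_contra h
    exact hs.2 ⟨h1, by linarith⟩
  rw [cut _ (fun s hs => by rw [hψ0 _ (by gcongr)]; simp),
    cut _ (fun s hs => by rw [hgR _ hs]; simp)] at ibp
  have hw : ∀ s ∈ uIcc 0 R, HasDerivAt (fun s : ℝ => ψ (s^2)) (-(2 * s * g s)) s := by
    intro s hs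
    rw [uIcc_of_le hR.le] at hs
    have := (hψd (s^2)).comp s (hasDerivAt_pow 2 s)
    refine HasDerivAt.congr_deriv this ?_
    simp only [hk, Real.sqrt_sq hs.1]
    push_cast
    ring
  have ibp2 := intervalIntegral.integral_mul_deriv_eq_deriv_mul (a := 0) (b := R) hw (fun s _ => hPd s)
    (by apply Continuous.intervalIntegrable; fun_prop) (cS'.intervalIntegrable _ _)
  have hP0 : P 0 = 0 := by simp [hP]
  rw [ibp, hψ0 (R^2) le_rfl, hP0] at ibp2
  have fin : ∫ s, g s • Er s = ∫ s in (0:ℝ)..R, g s * Er s := by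
    rw [← cut _ (fun s hs => by rw [hgR _ hs]; simp)]
    rw [setIntegral_eq_integral_of_forall_compl_eq_zero]
    · rfl
    · intro s hs
      rw [hg0 s (by simpa using hs)]; simp
  rw [fin]
  have h3 : ∫ s in (0:ℝ)..R, g s * Er s =
      (1/2) * ((∫ s in (0:ℝ)..R, 2 * g s * SI (fun x => f x * x i) s) +
        ∫ s in (0:ℝ)..R, -(2 * s * g s) * P s) := by
    rw [← intervalIntegral.integral_add, ← intervalIntegral.integral_const_mul]
    · congr 1; ext s; simp only [hEr]; ring
    · apply Continuous.intervalIntegrable; fun_prop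
    · apply Continuous.intervalIntegrable; fun_prop
  rw [h3, ibp2]
  ring

lemma almgren_ode (n : ℝ) (hn : 1 ≤ n) (R : ℝ) (a b g q : ℝ → ℝ) (ca : Continuous a) (cb : Continuous b)
    (cg : Continuous g)
    (ha : ∀ r, 0 < r → 0 ≤ a r) (hg : ∀ r, 0 < r → 0 ≤ g r)
    (h1 : ∀ r, 0 < r → r < R → b r = r * ∫ s in (0:ℝ)..r, g s)
    (h2 : ∀ r, 0 < r → r ^ 2 * a r = r * ∫ s in (0:ℝ)..r, (n * a s + 2 * b s))
    (h3 : ∀ r, 0 < r → r < R → r ^ 2 * g r - 2 * q r = r * ((n - 2) * ∫ s in (0:ℝ)..r, g s))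
    (hcs : ∀ r, 0 < r → b r ^ 2 ≤ a r * q r) (r₁ r₂ : ℝ) (hr₁ : 0 < r₁) (hr : r₁ ≤ r₂) (hr₂ : r₂ < R) :
    r₁ * (∫ s in (0:ℝ)..r₁, g s) / a r₁ ≤ r₂ * (∫ s in (0:ℝ)..r₂, g s) / a r₂ := by
  set D : ℝ → ℝ := fun r => ∫ s in (0:ℝ)..r, g s with hD
  have dD : ∀ s, HasDerivAt D (g s) s := fun s => (cg.integral_hasStrictDerivAt 0 s).hasDerivAt
  have D0 : ∀ r, 0 < r → 0 ≤ D r := by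
    intro r hr
    refine intervalIntegral.integral_nonneg_of_ae_restrict hr.le ?_
    rw [Filter.EventuallyLE, ae_restrict_iff' measurableSet_Icc]
    have : ∀ᵐ x : ℝ, x ≠ 0 := by simp [ae_iff]
    filter_upwards [this] with x hx hx'
    exact hg x (lt_of_le_of_ne hx'.1 hx.symm)
  have da : ∀ r, 0 < r → HasDerivAt a (((n - 1) * a r + 2 * b r) / r) r := by
    intro r hr
    have hc : Continuous (fun s => n * a s + 2 * b s) := by fun_prop
    have e1 : HasDerivAt (fun r => (∫ s in (0:ℝ)..r, (n * a s + 2 * b s)) / r) _ r :=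
      (hc.integral_hasStrictDerivAt 0 r).hasDerivAt.div (hasDerivAt_id r) hr.ne'
    have key : ∀ r, 0 < r → a r = (∫ s in (0:ℝ)..r, (n * a s + 2 * b s)) / r := by
      intro r hr
      have := h2 r hr
      rw [eq_div_iff hr.ne']
      apply mul_left_cancel₀ hr.ne'
      rw [← this]; ring
    have e2 := e1.congr_of_eventuallyEq (f₁ := a)
      (by filter_upwards [Ioi_mem_nhds hr] with s hs using key s hs)
    refine e2.congr_deriv ?_
    have k := key r hr
    rw [eq_div_iff hr.ne'] at k
    rw [← k]
    field_simp
    ring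
  have amono : MonotoneOn a (Ioo 0 R) := by
    refine monotoneOn_of_deriv_nonneg (convex_Ioo 0 R) ca.continuousOn ?_ ?_
    · intro x hx; rw [interior_Ioo] at hx
      exact (da x hx.1).differentiableAt.differentiableWithinAt
    · intro x hx; rw [interior_Ioo] at hx
      rw [(da x hx.1).deriv, h1 x hx.1 hx.2]
      have := ha x hx.1
      have := D0 x hx.1
      have : 0 < x := hx.1
      have : 0 ≤ n - 1 := by linarith
      positivity
  have hr₂0 : 0 < r₂ := by linarith
  rcases (ha r₁ hr₁).eq_or_lt with h0 | hpos
  · rw [← h0, _root_.div_zero]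
    have := ha r₂ hr₂0
    have := D0 r₂ hr₂0
    exact div_nonneg (mul_nonneg hr₂0.le this) (by assumption)
  have apos : ∀ x ∈ Icc r₁ r₂, 0 < a x := fun x hx =>
    hpos.trans_le (amono ⟨hr₁, by linarith⟩ ⟨by linarith [hx.1], by linarith [hx.2]⟩ hx.1)
  have dN : ∀ x ∈ Icc r₁ r₂, HasDerivAt (fun r => r * D r / a r)
      (((1 * D x + x * g x) * a x - x * D x * (((n - 1) * a x + 2 * b x) / x)) / a x ^ 2) x := by
    intro x hx
    have hx0 : 0 < x := by linarith [hx.1]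
    exact ((hasDerivAt_id x).mul (dD x)).div (da x hx0) (apos x hx).ne'
  have Nmono : MonotoneOn (fun r => r * D r / a r) (Icc r₁ r₂) := by
    refine monotoneOn_of_deriv_nonneg (convex_Icc _ _)
      (fun x hx => (dN x hx).continuousAt.continuousWithinAt) ?_ ?_
    · intro x hx
      exact (dN x (interior_subset hx)).differentiableAt.differentiableWithinAt
    · intro x hx
      have hx := interior_subset hx
      have hx0 : 0 < x := by linarith [hx.1]
      have hxR : x < R := by linarith [hx.2]
      rw [(dN x hx).deriv]
      refine div_nonneg ?_ (sq_nonneg _)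
      have k1 := h1 x hx0 hxR
      have k3 := h3 x hx0 hxR
      have kc := hcs x hx0
      change b x = x * D x at k1
      change _ = x * ((n - 2) * D x) at k3
      have hgx : x * g x = (n - 2) * D x + 2 * q x / x := by
        field_simp
        linarith
      have : (1 * D x + x * g x) * a x - x * D x * (((n - 1) * a x + 2 * b x) / x) =
          2 / x * (a x * q x - b x ^ 2) := by
        rw [hgx, k1]
        field_simp
        ring
      rw [this]
      exact mul_nonneg (by positivity) (by linarith)
  exact Nmono ⟨le_rfl, hr⟩ ⟨hr, le_rfl⟩ hr

section SIlemmas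
variable {d : ℕ}

lemma SI_int {f : EuclideanSpace ℝ (Fin d) → ℝ} (hf : Continuous f) (r : ℝ) :
    Integrable (fun θ : sphere (0 : EuclideanSpace ℝ (Fin d)) 1 => f (r • (θ : EuclideanSpace ℝ (Fin d))))
      (volume : Measure (EuclideanSpace ℝ (Fin d))).toSphere := by
  have : Continuous (fun θ : sphere (0 : EuclideanSpace ℝ (Fin d)) 1 => f (r • (θ : EuclideanSpace ℝ (Fin d)))) := by
    fun_prop
  exact this.integrable_of_hasCompactSupport (HasCompactSupport.of_compactSpace _)

lemma SI_add {f g : EuclideanSpace ℝ (Fin d) → ℝ} (hf : Continuous f) (hg : Continuous g) (r : ℝ) :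
    SI (fun x => f x + g x) r = SI f r + SI g r := by
  unfold SI
  rw [integral_add (SI_int hf r) (SI_int hg r)]; ring

lemma SI_const_mul (c : ℝ) (f : EuclideanSpace ℝ (Fin d) → ℝ) (r : ℝ) :
    SI (fun x => c * f x) r = c * SI f r := by
  unfold SI
  rw [integral_const_mul]; ring

lemma SI_sum {f : Fin d → EuclideanSpace ℝ (Fin d) → ℝ} (hf : ∀ i, Continuous (f i)) (r : ℝ) :
    SI (fun x => ∑ i, f i x) r = ∑ i, SI (f i) r := by
  unfold SI
  rw [integral_finsetSum _ (fun i _ => SI_int (hf i) r), Finset.mul_sum]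

lemma SI_congr {f g : EuclideanSpace ℝ (Fin d) → ℝ} (r : ℝ) (hr : 0 ≤ r) (h : ∀ x, ‖x‖ = r → f x = g x) :
    SI f r = SI g r := by
  unfold SI
  congr 1
  refine integral_congr_ae (Eventually.of_forall fun θ => h _ ?_)
  rw [norm_smul, norm_eq_of_mem_sphere, mul_one, Real.norm_eq_abs, abs_of_nonneg hr]

lemma SI_nonneg {f : EuclideanSpace ℝ (Fin d) → ℝ} (hf : ∀ x, 0 ≤ f x) (r : ℝ) (hr : 0 ≤ r) : 0 ≤ SI f r :=
  mul_nonneg (pow_nonneg hr _) (integral_nonneg fun _ => hf _)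

lemma SI_cs {f g : EuclideanSpace ℝ (Fin d) → ℝ} (hf : Continuous f) (hg : Continuous g) (r : ℝ) (hr : 0 ≤ r) :
    SI (fun x => f x * g x) r ^ 2 ≤ SI (fun x => f x ^ 2) r * SI (fun x => g x ^ 2) r := by
  have key : ∀ t : ℝ, 0 ≤ SI (fun x => f x ^ 2) r * (t * t) + (2 * SI (fun x => f x * g x) r) * t +
      SI (fun x => g x ^ 2) r := by
    intro t
    have h0 := SI_nonneg (f := fun x => (t * f x + g x) ^ 2) (fun x => sq_nonneg _) r hr
    have e : (fun x => (t * f x + g x) ^ 2) =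
        fun x => ((t * t) * (f x ^ 2) + (2 * t) * (f x * g x)) + g x ^ 2 := by
      ext x; ring
    rw [e, SI_add (by fun_prop) (by fun_prop), SI_add (by fun_prop) (by fun_prop), SI_const_mul,
      SI_const_mul] at h0
    linarith
  have := discrim_le_zero key
  unfold discrim at this
  nlinarith

lemma div_vec (hd : 2 ≤ d) {X : Fin d → EuclideanSpace ℝ (Fin d) → ℝ} (hX : ∀ i, ContDiff ℝ 1 (X i))
    (r : ℝ) (hr : 0 < r) :
    SI (fun x => ∑ i, X i x * x i) r =
      r * ∫ s in (0:ℝ)..r, SI (fun x => ∑ i, fderiv ℝ (X i) x (EuclideanSpace.single i 1)) s := by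
  have c : ∀ i, Continuous (X i) := fun i => (hX i).continuous
  have c' : ∀ i, Continuous (fun x => fderiv ℝ (X i) x (EuclideanSpace.single i 1)) := fun i =>
    ((hX i).continuous_fderiv one_ne_zero).clm_apply continuous_const
  rw [SI_sum (fun i => by have := c i; fun_prop)]
  simp_rw [SI_sum c']
  rw [intervalIntegral.integral_finsetSum (fun i _ => (SI_continuous (c' i)).intervalIntegrable _ _),
    Finset.mul_sum]
  exact Finset.sum_congr rfl fun i _ => div_scalar hd (hX i) i r hr

end SIlemmas

section Main
variable {d : ℕ}

lemma norm_gradient_sq (u : EuclideanSpace ℝ (Fin d) → ℝ) (x : EuclideanSpace ℝ (Fin d)) :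
    ‖gradient u x‖ ^ 2 = ∑ i, fderiv ℝ u x (EuclideanSpace.single i 1) ^ 2 := by
  rw [EuclideanSpace.real_norm_sq_eq]
  refine Finset.sum_congr rfl fun i _ => ?_
  congr 1
  have h1 : inner ℝ (gradient u x) (EuclideanSpace.single i (1:ℝ)) = fderiv ℝ u x (EuclideanSpace.single i 1) := by
    simp only [gradient, InnerProductSpace.toDual_symm_apply]
  rw [← h1, EuclideanSpace.inner_single_right]
  simp

lemma almgren_global (hd : 2 ≤ d) (u : EuclideanSpace ℝ (Fin d) → ℝ) (hu : ContDiff ℝ 2 u) (R : ℝ)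
    (hl : ∀ x, ‖x‖ < R → lap u x = 0) (r₁ r₂ : ℝ) (hr₁ : 0 < r₁) (hr : r₁ ≤ r₂) (hr₂ : r₂ < R) :
    frequency u r₁ ≤ frequency u r₂ := by
  obtain ⟨c, hc, hH⟩ := hausdorff_sphere hd
  set p : Fin d → EuclideanSpace ℝ (Fin d) → ℝ := fun i x => fderiv ℝ u x (EuclideanSpace.single i 1) with hp
  have hpc : ∀ i, ContDiff ℝ 1 (p i) := fun i =>
    (hu.fderiv_right (m := 1) (by norm_num)).clm_apply contDiff_const
  have hu1 : ContDiff ℝ 1 u := hu.of_le (by norm_num)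
  have cu : Continuous u := hu.continuous
  have cp : ∀ i, Continuous (p i) := fun i => (hpc i).continuous
  have cxi : ∀ i : Fin d, ContDiff ℝ 1 (fun x : EuclideanSpace ℝ (Fin d) => x i) := fun i => by fun_prop
  have dx : ∀ (i : Fin d) (x : EuclideanSpace ℝ (Fin d)), HasFDerivAt (fun x : EuclideanSpace ℝ (Fin d) => x i)
      (EuclideanSpace.proj i : EuclideanSpace ℝ (Fin d) →L[ℝ] ℝ) x := fun i x =>
    (EuclideanSpace.proj i : EuclideanSpace ℝ (Fin d) →L[ℝ] ℝ).hasFDerivAt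
  have du : ∀ x, HasFDerivAt u (fderiv ℝ u x) x := fun x =>
    (hu1.differentiable one_ne_zero x).hasFDerivAt
  have dp : ∀ i x, HasFDerivAt (p i) (fderiv ℝ (p i) x) x := fun i x =>
    ((hpc i).differentiable one_ne_zero x).hasFDerivAt
  have sym : ∀ i j x, fderiv ℝ (p i) x (EuclideanSpace.single j 1) =
      fderiv ℝ (p j) x (EuclideanSpace.single i 1) := by
    intro i j x
    have hs : IsSymmSndFDerivAt ℝ u x := hu.contDiffAt.isSymmSndFDerivAt (by simp)
    have hdd : DifferentiableAt ℝ (fderiv ℝ u) x :=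
      (hu.fderiv_right (m := 1) (by norm_num)).differentiable one_ne_zero x
    have e : ∀ k v, fderiv ℝ (p k) x v = fderiv ℝ (fderiv ℝ u) x v (EuclideanSpace.single k 1) := by
      intro k v
      rw [hp]
      simp only
      rw [fderiv_clm_apply hdd (by fun_prop)]
      simp
    rw [e, e]
    exact hs _ _
  set w : EuclideanSpace ℝ (Fin d) → ℝ := fun x => ∑ j, p j x * x j with hw
  set G : EuclideanSpace ℝ (Fin d) → ℝ := fun x => ∑ j, p j x ^ 2 with hG
  have wc : ContDiff ℝ 1 w := ContDiff.sum fun j _ => (hpc j).mul (cxi j)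
  have Gc : ContDiff ℝ 1 G := ContDiff.sum fun j _ => (hpc j).pow 2
  have cw := wc.continuous
  have cG := Gc.continuous
  have dw : ∀ x v, fderiv ℝ w x v = ∑ j, (p j x * v j + x j * fderiv ℝ (p j) x v) := by
    intro x v
    have : HasFDerivAt w _ x := HasFDerivAt.fun_sum fun j _ => (dp j x).mul (dx j x)
    rw [this.fderiv]
    simp
  have dG : ∀ x v, fderiv ℝ G x v = ∑ j, 2 * p j x * fderiv ℝ (p j) x v := by
    intro x v
    have : HasFDerivAt G _ x := HasFDerivAt.fun_sum fun j _ => (dp j x).pow 2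
    rw [this.fderiv]
    simp
  have dw' : ∀ x, HasFDerivAt w (fderiv ℝ w x) x := fun x => (wc.differentiable one_ne_zero x).hasFDerivAt
  have dG' : ∀ x, HasFDerivAt G (fderiv ℝ G x) x := fun x => (Gc.differentiable one_ne_zero x).hasFDerivAt
  have hl' : ∀ x, ‖x‖ < R → ∑ i, fderiv ℝ (p i) x (EuclideanSpace.single i 1) = 0 := hl
  have hxx : ∀ x : EuclideanSpace ℝ (Fin d), ∑ i, x i * x i = ‖x‖ ^ 2 := by
    intro x
    rw [EuclideanSpace.real_norm_sq_eq]
    exact Finset.sum_congr rfl fun i _ => by ring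
  -- identity 1
  have h1 : ∀ r, 0 < r → r < R → SI (fun x => u x * w x) r = r * ∫ s in (0:ℝ)..r, SI G s := by
    intro r hr hrR
    have := div_vec hd (X := fun i x => u x * p i x) (fun i => hu1.mul (hpc i)) r hr
    have e : (fun x : EuclideanSpace ℝ (Fin d) => ∑ i, u x * p i x * x i) = fun x => u x * w x := by
      ext x; rw [hw]; simp only; rw [Finset.mul_sum]; exact Finset.sum_congr rfl fun i _ => by ring
    rw [e] at this
    rw [this]
    congr 1
    refine intervalIntegral.integral_congr fun s hs => ?_
    rw [uIcc_of_le hr.le] at hs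
    refine SI_congr s hs.1 fun x hx => ?_
    have e2 : ∀ i, fderiv ℝ (fun x => u x * p i x) x (EuclideanSpace.single i 1) =
        u x * fderiv ℝ (p i) x (EuclideanSpace.single i 1) + p i x ^ 2 := by
      intro i
      have t : HasFDerivAt (fun x => u x * p i x) _ x := (du x).mul (dp i x)
      rw [t.fderiv]
      simp [hp, sq]
    simp_rw [e2]
    rw [Finset.sum_add_distrib, ← Finset.mul_sum, hl' x (by linarith [hs.2])]
    simp [hG]
  -- identity 2
  have h2 : ∀ r, 0 < r → r ^ 2 * SI (fun x => u x ^ 2) r =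
      r * ∫ s in (0:ℝ)..r, ((d:ℝ) * SI (fun x => u x ^ 2) s + 2 * SI (fun x => u x * w x) s) := by
    intro r hr
    have := div_vec hd (X := fun i x => u x ^ 2 * x i) (fun i => (hu1.pow 2).mul (cxi i)) r hr
    have e : SI (fun x : EuclideanSpace ℝ (Fin d) => ∑ i, u x ^ 2 * x i * x i) r = r ^ 2 * SI (fun x => u x ^ 2) r := by
      rw [← SI_const_mul]
      refine SI_congr r hr.le fun x hx => ?_
      simp_rw [mul_assoc]
      rw [← Finset.mul_sum, hxx, hx]; ring
    rw [e] at this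
    rw [this]
    congr 1
    refine intervalIntegral.integral_congr fun s hs => ?_
    rw [uIcc_of_le hr.le] at hs
    simp only
    rw [← SI_const_mul, ← SI_const_mul, ← SI_add (by fun_prop) (by fun_prop)]
    refine SI_congr s hs.1 fun x hx => ?_
    have e2 : ∀ i, fderiv ℝ (fun x : EuclideanSpace ℝ (Fin d) => u x ^ 2 * x i) x (EuclideanSpace.single i 1) =
        u x ^ 2 + 2 * (u x * (p i x * x i)) := by
      intro i
      have t : HasFDerivAt (fun x : EuclideanSpace ℝ (Fin d) => u x ^ 2 * x i) _ x :=
        ((du x).pow 2).mul (dx i x)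
      rw [t.fderiv]
      simp [hp]
      ring
    simp_rw [e2]
    rw [Finset.sum_add_distrib, ← Finset.mul_sum, ← Finset.mul_sum]
    simp [hw]
  -- identity 3
  have h3 : ∀ r, 0 < r → r < R → r ^ 2 * SI G r - 2 * SI (fun x => w x ^ 2) r =
      r * (((d:ℝ) - 2) * ∫ s in (0:ℝ)..r, SI G s) := by
    intro r hr hrR
    have := div_vec hd (X := fun i x => G x * x i - 2 * (w x * p i x))
      (fun i => (Gc.mul (cxi i)).sub (contDiff_const.mul (wc.mul (hpc i)))) r hr
    have e : SI (fun x : EuclideanSpace ℝ (Fin d) => ∑ i, (G x * x i - 2 * (w x * p i x)) * x i) r =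
        r ^ 2 * SI G r - 2 * SI (fun x => w x ^ 2) r := by
      rw [sub_eq_add_neg, ← neg_mul, ← SI_const_mul, ← SI_const_mul, ← SI_add (by fun_prop) (by fun_prop)]
      refine SI_congr r hr.le fun x hx => ?_
      have : ∀ i, (G x * x i - 2 * (w x * p i x)) * x i = G x * (x i * x i) + (-2 * w x) * (p i x * x i) := by
        intro i; ring
      simp_rw [this]
      rw [Finset.sum_add_distrib, ← Finset.mul_sum, ← Finset.mul_sum, hxx, hx]
      change _ + -2 * w x * w x = _
      ring
    rw [e] at this
    rw [this]
    congr 1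
    rw [← intervalIntegral.integral_const_mul]
    refine intervalIntegral.integral_congr fun s hs => ?_
    rw [uIcc_of_le hr.le] at hs
    simp only
    rw [← SI_const_mul]
    refine SI_congr s hs.1 fun x hx => ?_
    have e2 : ∀ i, fderiv ℝ (fun x : EuclideanSpace ℝ (Fin d) => G x * x i - 2 * (w x * p i x)) x
        (EuclideanSpace.single i 1) =
        G x + ∑ j, 2 * p j x * fderiv ℝ (p j) x (EuclideanSpace.single i 1) * x i
         - 2 * (w x * fderiv ℝ (p i) x (EuclideanSpace.single i 1)) - 2 * p i x ^ 2
         - ∑ j, 2 * p i x * fderiv ℝ (p i) x (EuclideanSpace.single j 1) * x j := by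
      intro i
      have t : HasFDerivAt (fun x : EuclideanSpace ℝ (Fin d) => G x * x i - 2 * (w x * p i x)) _ x :=
        ((dG' x).mul (dx i x)).sub (((dw' x).mul (dp i x)).const_mul 2)
      rw [t.fderiv]
      have hwi : fderiv ℝ w x (EuclideanSpace.single i 1) =
          p i x + ∑ j, x j * fderiv ℝ (p i) x (EuclideanSpace.single j 1) := by
        rw [dw, Finset.sum_add_distrib]
        congr 1
        · simp [Finset.sum_ite_eq, EuclideanSpace.single_apply]
        · exact Finset.sum_congr rfl fun j _ => by rw [sym j i]
      simp only [ContinuousLinearMap.sub_apply, ContinuousLinearMap.add_apply, ContinuousLinearMap.smul_apply,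
        smul_eq_mul, hwi, dG]
      have a1 : ∑ j, 2 * p j x * fderiv ℝ (p j) x (EuclideanSpace.single i 1) * x i =
          x i * ∑ j, 2 * p j x * fderiv ℝ (p j) x (EuclideanSpace.single i 1) := by
        rw [Finset.mul_sum]; exact Finset.sum_congr rfl fun j _ => by ring
      have a2 : ∑ j, 2 * p i x * fderiv ℝ (p i) x (EuclideanSpace.single j 1) * x j =
          2 * p i x * ∑ j, x j * fderiv ℝ (p i) x (EuclideanSpace.single j 1) := by
        rw [Finset.mul_sum]; exact Finset.sum_congr rfl fun j _ => by ring
      rw [a1, a2]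
      simp
      ring
    simp_rw [e2]
    simp only [Finset.sum_sub_distrib, Finset.sum_add_distrib]
    rw [← Finset.mul_sum, ← Finset.mul_sum, ← Finset.mul_sum, hl' x (by linarith [hs.2])]
    have ec : ∑ i, ∑ j, 2 * p j x * fderiv ℝ (p j) x (EuclideanSpace.single i 1) * x i =
        ∑ i, ∑ j, 2 * p i x * fderiv ℝ (p i) x (EuclideanSpace.single j 1) * x j := Finset.sum_comm
    have eg : ∑ _i : Fin d, G x = d * G x := by
      rw [Finset.sum_const, Finset.card_univ, Fintype.card_fin, nsmul_eq_mul]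
    have eg' : ∑ i, p i x ^ 2 = G x := rfl
    rw [ec, eg, eg']
    ring
  have key := almgren_ode d (by exact_mod_cast (by omega : 1 ≤ d)) R (SI (fun x => u x ^ 2))
    (SI (fun x => u x * w x)) (SI G) (SI (fun x => w x ^ 2)) (SI_continuous (by fun_prop))
    (SI_continuous (by fun_prop)) (SI_continuous cG)
    (fun r hr => SI_nonneg (fun x => sq_nonneg _) r hr.le)
    (fun r hr => SI_nonneg (fun x => Finset.sum_nonneg fun i _ => sq_nonneg _) r hr.le)
    h1 h2 h3 (fun r hr => SI_cs cu cw r hr.le) r₁ r₂ hr₁ hr hr₂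
  have freq : ∀ r, 0 < r → frequency u r = c⁻¹ * (r * (∫ s in (0:ℝ)..r, SI G s) / SI (fun x => u x ^ 2) r) := by
    intro r hr
    unfold frequency
    rw [hH (fun x => u x ^ 2) (by fun_prop) (fun x => sq_nonneg _) r hr, ← ball_polar hd cG r hr]
    simp_rw [norm_gradient_sq]
    rw [mul_comm c, ← div_div, div_eq_mul_inv _ c, mul_comm _ c⁻¹]
  rw [freq r₁ hr₁, freq r₂ (by linarith)]
  exact mul_le_mul_of_nonneg_left key (inv_nonneg.2 hc)

end Main

theorem almgren_monotonicity
    (d : ℕ) (hd : 2 ≤ d)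
    (u : EuclideanSpace ℝ (Fin d) → ℝ)
    (hu : HarmonicOn u (ball 0 1))
    (hnz : ∃ x ∈ ball (0 : EuclideanSpace ℝ (Fin d)) 1, u x ≠ 0) :
    MonotoneOn (frequency u) (Ioo 0 1) := by
  intro a ha b hb hab
  obtain ⟨R, hbR, hR1⟩ := exists_between hb.2
  obtain ⟨R', hRR', hR'1⟩ := exists_between hR1
  have hR0 : 0 < R := hb.1.trans hbR
  let χ : ContDiffBump (0 : EuclideanSpace ℝ (Fin d)) := ⟨R, R', hR0, hRR'⟩
  set v : EuclideanSpace ℝ (Fin d) → ℝ := fun x => χ x * u x with hv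
  have hvu : EqOn v u (ball 0 R) := by
    intro x hx
    have : χ x = 1 := χ.one_of_mem_closedBall (ball_subset_closedBall hx)
    simp [hv, this]
  have hvc : ContDiff ℝ 2 v := by
    rw [contDiff_iff_contDiffAt]
    intro x
    by_cases hx : x ∈ ball (0 : EuclideanSpace ℝ (Fin d)) 1
    · exact (χ.contDiff.contDiffAt).mul (hu.1.contDiffAt (isOpen_ball.mem_nhds hx))
    · have : v =ᶠ[𝓝 x] fun _ => 0 := by
        have hx' : x ∈ (closedBall (0 : EuclideanSpace ℝ (Fin d)) R')ᶜ := by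
          simp only [mem_ball_zero_iff, not_lt] at hx
          simp only [mem_compl_iff, mem_closedBall_zero_iff, not_le]
          linarith
        filter_upwards [isClosed_closedBall.isOpen_compl.mem_nhds hx'] with y hy
        have : χ y = 0 := by
          apply χ.zero_of_le_dist
          simp only [mem_compl_iff, mem_closedBall, not_le] at hy
          exact hy.le
        simp [hv, this]
      exact contDiffAt_const.congr_of_eventuallyEq this
  have hvl : ∀ x, ‖x‖ < R → lap v x = 0 := by
    intro x hx
    have hxR : x ∈ ball (0 : EuclideanSpace ℝ (Fin d)) R := by simpa using hx
    rw [← hu.2 x (ball_subset_ball hR1.le hxR)]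
    unfold lap
    refine Finset.sum_congr rfl fun i _ => ?_
    have : (fun y => fderiv ℝ v y (EuclideanSpace.single i 1)) =ᶠ[𝓝 x]
        fun y => fderiv ℝ u y (EuclideanSpace.single i 1) := by
      filter_upwards [isOpen_ball.mem_nhds hxR] with y hy
      rw [(hvu.eventuallyEq_of_mem (isOpen_ball.mem_nhds hy)).fderiv_eq]
    rw [this.fderiv_eq]
  have hfr : ∀ r, 0 < r → r < R → frequency u r = frequency v r := by
    intro r _ hr
    unfold frequency
    have e1 : ∫ x in ball (0 : EuclideanSpace ℝ (Fin d)) r, ‖gradient u x‖ ^ 2 =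
        ∫ x in ball (0 : EuclideanSpace ℝ (Fin d)) r, ‖gradient v x‖ ^ 2 := by
      refine setIntegral_congr_fun measurableSet_ball fun x hx => ?_
      have hx := ball_subset_ball hr.le hx
      simp only [gradient]
      rw [(hvu.eventuallyEq_of_mem (isOpen_ball.mem_nhds hx)).fderiv_eq]
    have e2 : ∫ x in sphere (0 : EuclideanSpace ℝ (Fin d)) r, (u x) ^ 2 ∂μH[((d : ℝ) - 1)] =
        ∫ x in sphere (0 : EuclideanSpace ℝ (Fin d)) r, (v x) ^ 2 ∂μH[((d : ℝ) - 1)] := by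
      refine setIntegral_congr_fun isClosed_sphere.measurableSet fun x hx => ?_
      change u x ^ 2 = v x ^ 2
      rw [hvu]
      simp only [mem_sphere_iff_norm, sub_zero] at hx
      simpa [hx] using hr
    rw [e1, e2]
  rw [hfr a ha.1 (by linarith), hfr b hb.1 hbR]
  exact almgren_global hd v hvc R hvl a b ha.1 hab hbR
end
end

section
/- Let d ≥ 2 and let u be harmonic in B_1 ⊂ ℝ^d and not identically zero. Then there exists a nonnegative integer k such that the doubling index N(r) = log₂ ( ⨍_{∂B_{2r}} |u|² dH^{d−1} / ⨍_{∂B_r} |u|² dH^{d−1} )^{1/2} converges to k as r → 0; moreover k is the vanishing order of u at 0, i.e., the degree of the first nonvanishing term in the Taylor expansion of u at 0. -/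
open MeasureTheory Topology Filter Metric Set ENNReal

noncomputable section

/-- The sphere-average doubling index
`N(r) = log₂ ( ⨍_{∂B_{2r}} |u|² dH^{d-1} / ⨍_{∂B_r} |u|² dH^{d-1} )^{1/2}`. -/
def doublingIndex {d : ℕ} (u : EuclideanSpace ℝ (Fin d) → ℝ) (r : ℝ) : ℝ :=
  Real.logb 2 (Real.sqrt
    ((⨍ x in sphere (0 : EuclideanSpace ℝ (Fin d)) (2 * r), (u x) ^ 2 ∂μH[((d : ℝ) - 1)]) /
      ⨍ x in sphere (0 : EuclideanSpace ℝ (Fin d)) r, (u x) ^ 2 ∂μH[((d : ℝ) - 1)]))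

section Helpers
open scoped ContDiff Convolution

/-- second derivative test -/
lemma second_deriv_nonpos {f f' : ℝ → ℝ} {c : ℝ} (h1 : ∀ t, HasDerivAt f (f' t) t)
    (h2 : HasDerivAt f' c 0) (hm : IsLocalMax f 0) : c ≤ 0 := by
  by_contra hc
  push Not at hc
  have e1 : deriv f = f' := funext fun t => (h1 t).deriv
  have hmin : IsLocalMin f 0 := by
    apply isLocalMin_of_deriv_deriv_pos
    · rw [e1, h2.deriv]; exact hc
    · exact hm.deriv_eq_zero
    · exact (h1 0).continuousAt
  have hconst : f =ᶠ[𝓝 0] fun _ => f 0 := by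
    filter_upwards [hm, hmin] with t a b using le_antisymm a b
  have h3 : deriv f =ᶠ[𝓝 0] deriv (fun _ => f 0) := hconst.deriv
  have h4 := h3.deriv_eq
  rw [e1, h2.deriv] at h4
  simp at h4
  linarith

/-- directional derivative -/
def dd {d : ℕ} (v : EuclideanSpace ℝ (Fin d)) (h : EuclideanSpace ℝ (Fin d) → ℝ) :
    EuclideanSpace ℝ (Fin d) → ℝ := fun x => fderiv ℝ h x v

lemma dd_contDiff {d : ℕ} (v : EuclideanSpace ℝ (Fin d)) {h : EuclideanSpace ℝ (Fin d) → ℝ}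
    (hh : ContDiff ℝ ∞ h) : ContDiff ℝ ∞ (dd v h) := by
  unfold dd
  exact (hh.fderiv_right (m := ∞) (by norm_cast)).clm_apply contDiff_const

lemma dd_line {d : ℕ} (e a : EuclideanSpace ℝ (Fin d)) {h : EuclideanSpace ℝ (Fin d) → ℝ}
    (hh : ContDiff ℝ ∞ h) (t : ℝ) :
    HasDerivAt (fun s : ℝ => h (a + s • e)) (dd e h (a + t • e)) t := by
  have h1 : HasFDerivAt h (fderiv ℝ h (a + t • e)) (a + t • e) :=
    (hh.differentiable (by simp)).differentiableAt.hasFDerivAt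
  have h2 : HasDerivAt (fun s : ℝ => a + s • e) e t := by
    simpa using ((hasDerivAt_id t).smul_const e).const_add a
  exact h1.comp_hasDerivAt t h2

lemma dd_comm {d : ℕ} (v w : EuclideanSpace ℝ (Fin d)) {h : EuclideanSpace ℝ (Fin d) → ℝ}
    (hh : ContDiff ℝ ∞ h) : dd v (dd w h) = dd w (dd v h) := by
  have key : ∀ (v w x), dd v (dd w h) x = fderiv ℝ (fderiv ℝ h) x v w := by
    intro v w x
    have hd : DifferentiableAt ℝ (fderiv ℝ h) x :=
      ((hh.fderiv_right (m := ∞) (by norm_cast)).differentiable (by simp)).differentiableAt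
    have := (hd.hasFDerivAt.clm_apply (hasFDerivAt_const w x)).fderiv
    unfold dd
    rw [this]
    simp
  ext x
  rw [key, key]
  exact (hh.contDiffAt.isSymmSndFDerivAt (by simp; norm_cast)) v w

lemma lap_eq {d : ℕ} (h : EuclideanSpace ℝ (Fin d) → ℝ) (x : EuclideanSpace ℝ (Fin d)) :
    lap h x = ∑ i : Fin d, dd (EuclideanSpace.single i 1) (dd (EuclideanSpace.single i 1) h) x := rfl

lemma lap_dd {d : ℕ} (v : EuclideanSpace ℝ (Fin d)) {h : EuclideanSpace ℝ (Fin d) → ℝ}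
    (hh : ContDiff ℝ ∞ h) : lap (dd v h) = dd v (lap h) := by
  ext x
  have e : lap h = fun x =>
    ∑ i : Fin d, dd (EuclideanSpace.single i 1) (dd (EuclideanSpace.single i 1) h) x := rfl
  rw [lap_eq, e]
  conv_rhs => unfold dd
  rw [fderiv_fun_sum]
  · simp only [FunLike.coe_sum, Finset.sum_apply]
    refine Finset.sum_congr rfl fun i _ => ?_
    rw [dd_comm _ v hh, dd_comm _ v (dd_contDiff _ hh)]
    rfl
  · intro i _
    exact ((dd_contDiff _ (dd_contDiff _ hh)).differentiable (by simp)).differentiableAt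

lemma lap_dd_zero {d : ℕ} (v : EuclideanSpace ℝ (Fin d)) {h : EuclideanSpace ℝ (Fin d) → ℝ}
    (hh : ContDiff ℝ ∞ h) {U : Set (EuclideanSpace ℝ (Fin d))} (hU : IsOpen U)
    (h0 : ∀ x ∈ U, lap h x = 0) : ∀ x ∈ U, lap (dd v h) x = 0 := by
  intro x hx
  rw [lap_dd v hh]
  have : lap h =ᶠ[𝓝 x] fun _ => 0 := by
    filter_upwards [hU.mem_nhds hx] with y hy using h0 y hy
  unfold dd
  rw [this.fderiv_eq]
  simp

lemma dd_sq_le {d : ℕ} (v a : EuclideanSpace ℝ (Fin d)) (h : EuclideanSpace ℝ (Fin d) → ℝ) :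
    (dd v h a) ^ 2 ≤ ‖v‖ ^ 2 * ∑ i : Fin d, (dd (EuclideanSpace.single i 1) h a) ^ 2 := by
  have : dd v h a = ∑ i : Fin d, v i * dd (EuclideanSpace.single i 1) h a := by
    unfold dd
    conv_lhs => rw [← (EuclideanSpace.basisFun (Fin d) ℝ).sum_repr v]
    simp
  rw [this, EuclideanSpace.norm_sq_eq]
  simpa using Finset.sum_mul_sq_le_sq_mul_sq Finset.univ (fun i => v i)
    (fun i => dd (EuclideanSpace.single i 1) h a)

lemma bernstein_grad {d : ℕ} {h : EuclideanSpace ℝ (Fin d) → ℝ} (hh : ContDiff ℝ ∞ h)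
    (v x : EuclideanSpace ℝ (Fin d)) (hv : ‖v‖ = 1) {ρ M : ℝ} (hρ : 0 < ρ)
    (h0 : ∀ y ∈ ball x ρ, lap h y = 0) (hM : ∀ y ∈ closedBall x ρ, |h y| ≤ M) :
    |dd v h x| ≤ (13 + 2 * d) * M / ρ := by
  have hM0 : 0 ≤ M := (abs_nonneg _).trans (hM x (mem_closedBall_self hρ.le))
  have hg := dd_contDiff v hh
  have hg0 := lap_dd_zero v hh isOpen_ball h0
  set g := dd v h with hgdef
  set lam : ℝ := (13 + 2 * d) * ρ ^ 2 with hlam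
  have hlam0 : 0 < lam := by positivity
  set w : EuclideanSpace ℝ (Fin d) → ℝ :=
    fun y => (ρ ^ 2 - ‖y - x‖ ^ 2) ^ 2 * (g y) ^ 2 + lam * (h y) ^ 2 with hw
  have hwc : Continuous w := by
    have := hg.continuous
    have := hh.continuous
    fun_prop
  obtain ⟨a, ha, hmax⟩ := (isCompact_closedBall x ρ).exists_isMaxOn
    ⟨x, mem_closedBall_self hρ.le⟩ hwc.continuousOn
  have hsq : ∀ y ∈ closedBall x ρ, (h y) ^ 2 ≤ M ^ 2 := fun y hy =>
    sq_le_sq' (abs_le.1 (hM y hy)).1 (abs_le.1 (hM y hy)).2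
  have hwa : w a ≤ lam * M ^ 2 := by
    have hz : (ρ ^ 2 - ‖a - x‖ ^ 2) ^ 2 * (g a) ^ 2 = 0 := by
      rcases eq_or_lt_of_le (mem_closedBall.1 ha) with hb | hb
      · rw [dist_eq_norm] at hb
        rw [hb]; ring
      · have haball : a ∈ ball x ρ := hb
        have hloc : IsLocalMax w a :=
          hmax.isLocalMax (mem_of_superset (isOpen_ball.mem_nhds haball) ball_subset_closedBall)
        have hNb : ‖a - x‖ ^ 2 < ρ ^ 2 := by
          rw [dist_eq_norm] at hb
          exact pow_lt_pow_left₀ hb (norm_nonneg _) (by norm_num)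
        set N := ρ ^ 2 - ‖a - x‖ ^ 2 with hN
        have hcoord : ∀ i : Fin d,
            -24 * ((a - x) i) ^ 2 * (g a) ^ 2 - 4 * N * (g a) ^ 2
            + 2 * N ^ 2 * g a * dd (EuclideanSpace.single i 1) (dd (EuclideanSpace.single i 1) g) a
            + 2 * lam * (dd (EuclideanSpace.single i 1) h a) ^ 2
            + 2 * lam * h a * dd (EuclideanSpace.single i 1) (dd (EuclideanSpace.single i 1) h) a
             ≤ 0 := by
          intro i
          set e : EuclideanSpace ℝ (Fin d) := EuclideanSpace.single i 1 with he
          set b := (a - x) i with hb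
          have hH := dd_line e a hh
          have hH' := dd_line e a (dd_contDiff e hh)
          have hG := dd_line e a hg
          have hG' := dd_line e a (dd_contDiff e hg)
          have hNf : ∀ t : ℝ, ρ ^ 2 - ‖a + t • e - x‖ ^ 2 = N - 2 * b * t - t ^ 2 := by
            intro t
            have : a + t • e - x = (a - x) + t • e := by abel
            rw [this, norm_add_sq_real, inner_smul_right, norm_smul, he,
              EuclideanSpace.inner_single_right]
            simp [hN, ← hb]
            ring
          have hNd : ∀ t : ℝ, HasDerivAt (fun t : ℝ => N - 2 * b * t - t ^ 2) (- 2 * b - 2 * t) t := by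
            intro t
            have := (((hasDerivAt_id t).const_mul (2 * b)).const_sub N).sub (hasDerivAt_pow 2 t)
            exact this.congr_deriv (by simp)
          have hNd' : ∀ t : ℝ, HasDerivAt (fun t : ℝ => - 2 * b - 2 * t) (-2) t := by
            intro t
            have := ((hasDerivAt_id t).const_mul (2 : ℝ)).const_sub (-2 * b)
            exact this.congr_deriv (by simp)
          set Nf : ℝ → ℝ := fun t => N - 2 * b * t - t ^ 2 with hNfd
          set Nf' : ℝ → ℝ := fun t => - 2 * b - 2 * t with hNfd'
          set Gf : ℝ → ℝ := fun t => g (a + t • e) with hGf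
          set Gf' : ℝ → ℝ := fun t => dd e g (a + t • e) with hGf'
          set Hf : ℝ → ℝ := fun t => h (a + t • e) with hHf
          set Hf' : ℝ → ℝ := fun t => dd e h (a + t • e) with hHf'
          have h1 : ∀ t, HasDerivAt (fun t : ℝ => w (a + t • e))
              (2 * (Nf t * Nf' t * (Gf t * Gf t)) + 2 * (Nf t * Nf t * (Gf t * Gf' t))
                + 2 * lam * (Hf t * Hf' t)) t := by
            intro t
            have e1 : (fun t : ℝ => w (a + t • e)) =
                (Nf * Nf) * (Gf * Gf) + fun t => lam * (Hf * Hf) t := by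
              funext t
              simp only [hw, hNf, Pi.add_apply, Pi.mul_apply]
              simp only [hNfd, hGf, hHf]
              ring
            rw [e1]
            refine ((((hNd t).mul (hNd t)).mul ((hG t).mul (hG t))).add
              (((hH t).mul (hH t)).const_mul lam)).congr_deriv ?_
            simp only [Pi.mul_apply]
            simp only [hNfd, hNfd', hGf, hGf', hHf, hHf']
            ring
          have hm0 : IsLocalMax (fun t : ℝ => w (a + t • e)) 0 := by
            have hc : ContinuousAt (fun t : ℝ => a + t • e) 0 := by fun_prop
            have ht : Tendsto (fun t : ℝ => a + t • e) (𝓝 0) (𝓝 a) := by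
              simpa [ContinuousAt] using hc
            have := ht.eventually hloc
            simpa [IsLocalMax, IsMaxFilter] using this
          have h2 := second_deriv_nonpos h1
            ((((((hNd 0).mul (hNd' 0)).mul ((hG 0).mul (hG 0))).const_mul 2).add
              ((((hNd 0).mul (hNd 0)).mul ((hG 0).mul (hG' 0))).const_mul 2)).add
              (((hH 0).mul (hH' 0)).const_mul (2 * lam))) hm0
          simp [hNfd, hNfd', hGf, hGf', hHf, hHf'] at h2
          nlinarith [sq_nonneg (N * dd e g a - 4 * b * g a)]
        have hsum := Finset.sum_nonpos fun i (_ : i ∈ Finset.univ) => hcoord i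
        simp only [Finset.sum_add_distrib, Finset.sum_sub_distrib, ← Finset.mul_sum,
          ← Finset.sum_mul, ← lap_eq, h0 a haball, hg0 a haball] at hsum
        have hnorm : ∑ i, ((a - x) i) ^ 2 = ‖a - x‖ ^ 2 := by
          rw [EuclideanSpace.norm_sq_eq]; simp
        rw [hnorm] at hsum
        have hcs := dd_sq_le v a h
        rw [hv, ← hgdef] at hcs
        simp at hsum hcs
        have hga : g a ^ 2 * ρ ^ 2 ≤ 0 := by
          have hd0 : (0:ℝ) ≤ d := by positivity
          have p1 : 0 ≤ d * (ρ ^ 2 - N) * g a ^ 2 := by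
            apply mul_nonneg (mul_nonneg hd0 _) (sq_nonneg _)
            rw [hN]; nlinarith [sq_nonneg ‖a - x‖]
          have p2 : 0 ≤ (ρ ^ 2 - ‖a - x‖ ^ 2) * g a ^ 2 :=
            mul_nonneg (by linarith) (sq_nonneg _)
          have p3 : lam * g a ^ 2 ≤ lam * ∑ i, dd (EuclideanSpace.single i 1) h a ^ 2 :=
            mul_le_mul_of_nonneg_left hcs hlam0.le
          rw [hlam] at p3 hsum
          nlinarith
        have : g a ^ 2 = 0 := by
          have h5 : 0 < ρ ^ 2 := by positivity
          nlinarith [sq_nonneg (g a)]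
        rw [this]; ring
    simp only [hw]
    rw [hz, zero_add]
    exact mul_le_mul_of_nonneg_left (hsq a ha) hlam0.le
  have hwx : w x ≤ w a := hmax (mem_closedBall_self hρ.le)
  have h6 : (ρ ^ 2) ^ 2 * (g x) ^ 2 ≤ lam * M ^ 2 := by
    have : (ρ ^ 2) ^ 2 * (g x) ^ 2 ≤ w x := by
      simp only [hw, sub_self, norm_zero]
      have : 0 ≤ lam * (h x) ^ 2 := by positivity
      nlinarith
    linarith
  rw [le_div_iff₀ hρ]
  have h7 : (|g x| * ρ) ^ 2 ≤ ((13 + 2 * d) * M) ^ 2 := by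
    have h8 : (ρ ^ 2) * ((g x) ^ 2 * ρ ^ 2) ≤ ρ ^ 2 * ((13 + 2 * d) * M ^ 2) := by
      rw [hlam] at h6; nlinarith
    have h9 := le_of_mul_le_mul_left h8 (by positivity)
    rw [mul_pow, sq_abs]
    have hd0 : (0:ℝ) ≤ d := by positivity
    have : (13 + 2 * (d:ℝ)) * M ^ 2 ≤ ((13 + 2 * d) * M) ^ 2 := by
      rw [mul_pow]
      apply mul_le_mul_of_nonneg_right _ (sq_nonneg _)
      nlinarith
    linarith
  exact le_of_sq_le_sq h7 (by positivity)

lemma dd_bound {d : ℕ} {h : EuclideanSpace ℝ (Fin d) → ℝ} (hh : ContDiff ℝ ∞ h)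
    (v x : EuclideanSpace ℝ (Fin d)) {ρ M : ℝ} (hρ : 0 < ρ)
    (h0 : ∀ y ∈ ball x ρ, lap h y = 0) (hM : ∀ y ∈ closedBall x ρ, |h y| ≤ M) :
    |dd v h x| ≤ (13 + 2 * d) / ρ * M * ‖v‖ := by
  rcases eq_or_ne v 0 with rfl | hv
  · simp [dd]
  · have hv' : 0 < ‖v‖ := norm_pos_iff.2 hv
    have h1 := bernstein_grad hh (‖v‖⁻¹ • v) x (by rw [norm_smul]; simp [hv'.ne']) hρ h0 hM
    have h2 : dd (‖v‖⁻¹ • v) h x = ‖v‖⁻¹ * dd v h x := by simp [dd]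
    rw [h2, abs_mul, abs_of_pos (inv_pos.2 hv'), inv_mul_le_iff₀ hv'] at h1
    calc _ ≤ _ := h1
      _ = _ := by ring

lemma iteratedFDeriv_dd {d : ℕ} {h : EuclideanSpace ℝ (Fin d) → ℝ} (hh : ContDiff ℝ ∞ h) (n : ℕ)
    (x : EuclideanSpace ℝ (Fin d)) (v : Fin (n + 1) → EuclideanSpace ℝ (Fin d)) :
    iteratedFDeriv ℝ (n + 1) h x v =
      iteratedFDeriv ℝ n (dd (v (Fin.last n)) h) x (Fin.init v) := by
  rw [iteratedFDeriv_succ_apply_right]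
  have e : dd (v (Fin.last n)) h =
    (ContinuousLinearMap.apply ℝ ℝ (v (Fin.last n))) ∘ (fun y => fderiv ℝ h y) := by
    ext y; simp [dd]
  rw [e, ContinuousLinearMap.iteratedFDeriv_comp_left (n := ∞)]
  · simp
  · exact (hh.fderiv_right (m := ∞) (by norm_cast)).contDiffAt
  · norm_cast; exact le_top

lemma iter_bound {d : ℕ} {U : Set (EuclideanSpace ℝ (Fin d))} (hU : IsOpen U)
    (x : EuclideanSpace ℝ (Fin d)) {s : ℝ} (hs : 0 < s) (n : ℕ) :
    ∀ (h : EuclideanSpace ℝ (Fin d) → ℝ) (M : ℝ), ContDiff ℝ ∞ h → (∀ y ∈ U, lap h y = 0) →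
    closedBall x (n * s) ⊆ U → (∀ y ∈ closedBall x (n * s), |h y| ≤ M) →
    ∀ v : Fin n → EuclideanSpace ℝ (Fin d),
      |iteratedFDeriv ℝ n h x v| ≤ ((13 + 2 * d) / s) ^ n * M * ∏ i, ‖v i‖ := by
  induction n with
  | zero =>
    intro h M hh h0 hsub hM v
    simpa using hM x (by simp)
  | succ n ih =>
    intro h M hh h0 hsub hM v
    have hle : ∀ y ∈ closedBall x (n * s), closedBall y s ⊆ closedBall x ((n + 1 : ℕ) * s) := by
      intro y hy
      apply closedBall_subset_closedBall'
      push_cast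
      have := mem_closedBall.1 hy
      linarith
    rw [iteratedFDeriv_dd hh]
    have := ih (dd (v (Fin.last n)) h) ((13 + 2 * d) / s * M * ‖v (Fin.last n)‖)
      (dd_contDiff _ hh) (lap_dd_zero _ hh hU h0)
      (fun y hy => hsub (hle y hy (mem_closedBall_self hs.le)))
      (fun y hy => dd_bound hh _ y hs
        (fun z hz => h0 z (hsub (hle y hy (ball_subset_closedBall hz))))
        (fun z hz => hM z (hle y hy hz))) (Fin.init v)
    refine this.trans (le_of_eq ?_)
    rw [Fin.prod_univ_castSucc, pow_succ]
    simp only [Fin.init]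
    ring

/-- the constant in the analyticity estimates -/
def anC (d : ℕ) (R : ℝ) : ℝ := (13 + 2 * d) * 2 * Real.exp 1 / R

lemma deriv_bound {d : ℕ} {h : EuclideanSpace ℝ (Fin d) → ℝ} (hh : ContDiff ℝ ∞ h)
    {x₀ : EuclideanSpace ℝ (Fin d)} {R M : ℝ} (hR : 0 < R)
    (h0 : ∀ y ∈ ball x₀ R, lap h y = 0) (hM : ∀ y ∈ ball x₀ R, |h y| ≤ M)
    {x : EuclideanSpace ℝ (Fin d)} (hx : x ∈ closedBall x₀ (R / 4)) (n : ℕ) :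
    ‖iteratedFDeriv ℝ n h x‖ ≤ n.factorial * anC d R ^ n * M := by
  have hM0 : 0 ≤ M := (abs_nonneg _).trans (hM x₀ (mem_ball_self hR))
  have hA : 0 ≤ anC d R := by unfold anC; positivity
  rcases Nat.eq_zero_or_pos n with rfl | hn
  · rw [norm_iteratedFDeriv_zero]
    simpa using hM x (closedBall_subset_ball (by linarith) hx)
  have hn' : (0:ℝ) < n := by exact_mod_cast hn
  apply ContinuousMultilinearMap.opNorm_le_bound (by positivity)
  intro v
  have hsub : closedBall x (n * (R / (2 * n))) ⊆ ball x₀ R := by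
    have : n * (R / (2 * n)) = R / 2 := by field_simp
    rw [this]
    refine (closedBall_subset_closedBall' (ε₂ := 3 * R / 4) ?_).trans
      (closedBall_subset_ball (by linarith))
    have := mem_closedBall.1 hx
    linarith
  have := iter_bound isOpen_ball x (s := R / (2 * n)) (by positivity) n h M hh h0 hsub
    (fun y hy => hM y (hsub hy)) v
  rw [Real.norm_eq_abs]
  refine this.trans ?_
  gcongr
  have e : (13 + 2 * (d:ℝ)) / (R / (2 * n)) = (13 + 2 * d) * 2 / R * n := by field_simp
  have e2 : anC d R ^ n = ((13 + 2 * (d:ℝ)) * 2 / R) ^ n * Real.exp n := by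
    rw [← Real.exp_one_pow, ← mul_pow]; unfold anC; congr 1; ring
  rw [e, e2, mul_pow]
  have h3 := Real.pow_div_factorial_le_exp (x := (n:ℝ)) hn'.le n
  rw [div_le_iff₀ (by positivity)] at h3
  calc ((13 + 2 * (d:ℝ)) * 2 / R) ^ n * (n:ℝ) ^ n
      ≤ ((13 + 2 * (d:ℝ)) * 2 / R) ^ n * (Real.exp n * n.factorial) := by gcongr
    _ = _ := by ring

lemma lap_sub {d : ℕ} {h g : EuclideanSpace ℝ (Fin d) → ℝ} (hh : ContDiff ℝ ∞ h)
    (hg : ContDiff ℝ ∞ g) (x : EuclideanSpace ℝ (Fin d)) :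
    lap (h - g) x = lap h x - lap g x := by
  have key : ∀ (e : EuclideanSpace ℝ (Fin d)) {h g : EuclideanSpace ℝ (Fin d) → ℝ},
      ContDiff ℝ ∞ h → ContDiff ℝ ∞ g → dd e (h - g) = dd e h - dd e g := by
    intro e h g hh hg
    ext y
    simp only [dd, Pi.sub_apply]
    rw [fderiv_sub (hh.differentiable (by simp)).differentiableAt
      (hg.differentiable (by simp)).differentiableAt]
    simp
  rw [lap_eq, lap_eq, lap_eq, ← Finset.sum_sub_distrib]
  refine Finset.sum_congr rfl fun i _ => ?_
  rw [key _ hh hg, key _ (dd_contDiff _ hh) (dd_contDiff _ hg)]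
  rfl

lemma taylor_bound {d : ℕ} {h : EuclideanSpace ℝ (Fin d) → ℝ} (hh : ContDiff ℝ ∞ h)
    {x₀ : EuclideanSpace ℝ (Fin d)} {R M : ℝ} (hR : 0 < R)
    (h0 : ∀ y ∈ ball x₀ R, lap h y = 0) (hM : ∀ y ∈ ball x₀ R, |h y| ≤ M)
    {y : EuclideanSpace ℝ (Fin d)} (hy : ‖y‖ ≤ R / 4) (N : ℕ) :
    |h (x₀ + y) - ∑ k ∈ Finset.range (N + 1),
      ((k.factorial : ℝ)⁻¹ • iteratedFDeriv ℝ k h x₀) (fun _ => y)|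
      ≤ M * ((N + 1 : ℕ) * (anC d R * ‖y‖) ^ (N + 1)) := by
  have hM0 : 0 ≤ M := (abs_nonneg _).trans (hM x₀ (mem_ball_self hR))
  have hA : 0 ≤ anC d R := by unfold anC; positivity
  have ht := map_add_eq_sum_add_integral_iteratedFDeriv (f := h) (x := x₀) (y := y) (n := N)
    (fun t _ => hh.contDiffAt.of_le (by norm_cast; exact le_top))
  rw [ht]
  simp only [smul_apply, add_sub_cancel_left]
  rw [smul_eq_mul, abs_mul]
  have hb : ‖∫ t in (0:ℝ)..1, (1 - t) ^ N • iteratedFDeriv ℝ (N + 1) h (x₀ + t • y) (fun _ => y)‖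
      ≤ ((N + 1).factorial * anC d R ^ (N + 1) * M * ‖y‖ ^ (N + 1)) * |(1:ℝ) - 0| := by
    apply intervalIntegral.norm_integral_le_of_norm_le_const
    intro t ht
    rw [uIoc_of_le zero_le_one] at ht
    rw [norm_smul]
    have h1 : ‖(1 - t) ^ N‖ ≤ 1 := by
      rw [norm_pow]
      apply pow_le_one₀ (norm_nonneg _)
      rw [Real.norm_eq_abs, abs_le]
      constructor <;> linarith [ht.1, ht.2]
    have hx : x₀ + t • y ∈ closedBall x₀ (R / 4) := by
      rw [mem_closedBall, dist_eq_norm, add_sub_cancel_left, norm_smul, Real.norm_eq_abs,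
        abs_of_pos ht.1]
      nlinarith [ht.1, ht.2, norm_nonneg y]
    have h2 := (iteratedFDeriv ℝ (N + 1) h (x₀ + t • y)).le_opNorm (fun _ => y)
    have h3 := deriv_bound hh hR h0 hM hx (N + 1)
    calc _ ≤ 1 * (‖iteratedFDeriv ℝ (N + 1) h (x₀ + t • y)‖ * ∏ _i : Fin (N+1), ‖y‖) := by
          gcongr
      _ ≤ 1 * (((N + 1).factorial * anC d R ^ (N + 1) * M) * ∏ _i : Fin (N+1), ‖y‖) := by
          gcongr
      _ = _ := by simp
  rw [← Real.norm_eq_abs (∫ t in (0:ℝ)..1, _)]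
  calc _ ≤ |((N.factorial : ℝ))⁻¹| *
      (((N + 1).factorial * anC d R ^ (N + 1) * M * ‖y‖ ^ (N + 1)) * |(1:ℝ) - 0|) := by gcongr
    _ = _ := by
      have : (N.factorial : ℝ) ≠ 0 := by positivity
      rw [abs_of_nonneg (by positivity), Nat.factorial_succ, mul_pow]
      push_cast
      field_simp
      simp

lemma analytic_of_approx {d : ℕ} {u : EuclideanSpace ℝ (Fin d) → ℝ}
    {h : ℕ → EuclideanSpace ℝ (Fin d) → ℝ} (hh : ∀ n, ContDiff ℝ ∞ (h n))
    {x₀ : EuclideanSpace ℝ (Fin d)} {R M : ℝ} (hR : 0 < R)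
    (h0 : ∀ n, ∀ y ∈ ball x₀ R, lap (h n) y = 0) (hM : ∀ n, ∀ y ∈ ball x₀ R, |h n y| ≤ M)
    (hlim : TendstoUniformlyOn h u atTop (ball x₀ R)) : AnalyticAt ℝ u x₀ := by
  have hM0 : 0 ≤ M := (abs_nonneg _).trans (hM 0 x₀ (mem_ball_self hR))
  have hA : 0 < anC d R := by unfold anC; positivity
  have hmem : x₀ ∈ closedBall x₀ (R / 4) := mem_closedBall_self (by positivity)
  have hc : ∀ m : ℕ, ∃ p : ContinuousMultilinearMap ℝ (fun _ : Fin m => EuclideanSpace ℝ (Fin d)) ℝ,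
      Tendsto (fun n => (m.factorial : ℝ)⁻¹ • iteratedFDeriv ℝ m (h n) x₀) atTop (𝓝 p) := by
    intro m
    apply cauchySeq_tendsto_of_complete
    rw [Metric.cauchySeq_iff]
    intro ε hε
    have hAm : 0 < anC d R ^ m := pow_pos hA m
    have hcu := hlim.uniformCauchySeqOn
    rw [Metric.uniformCauchySeqOn_iff] at hcu
    obtain ⟨K, hK⟩ := hcu (ε / (2 * anC d R ^ m)) (by positivity)
    refine ⟨K, fun n hn k hk => ?_⟩
    have hsm : ContDiff ℝ ∞ (h n - h k) := (hh n).sub (hh k)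
    have := deriv_bound (h := h n - h k) hsm hR
      (fun y hy => by rw [lap_sub (hh n) (hh k), h0 n y hy, h0 k y hy, sub_zero])
      (M := ε / (2 * anC d R ^ m)) (fun y hy => by
        have := hK n hn k hk y hy
        rw [Real.dist_eq] at this
        exact this.le) hmem m
    rw [iteratedFDeriv_sub_apply ((hh n).contDiffAt.of_le (by norm_cast; exact le_top))
      ((hh k).contDiffAt.of_le (by norm_cast; exact le_top))] at this
    have esub : (m.factorial : ℝ)⁻¹ • iteratedFDeriv ℝ m (h n) x₀
        - (m.factorial : ℝ)⁻¹ • iteratedFDeriv ℝ m (h k) x₀ = (m.factorial : ℝ)⁻¹ •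
          (iteratedFDeriv ℝ m (h n) x₀ - iteratedFDeriv ℝ m (h k) x₀) := (smul_sub _ _ _).symm
    rw [dist_eq_norm, esub, norm_smul]
    have hf : (0:ℝ) < m.factorial := by positivity
    rw [norm_inv, Real.norm_natCast, inv_mul_lt_iff₀ hf]
    refine this.trans_lt ?_
    have : (m.factorial : ℝ) * anC d R ^ m * (ε / (2 * anC d R ^ m)) = m.factorial * (ε / 2) := by
      field_simp
    rw [this]
    nlinarith
  choose p hp using hc
  have hpn : ∀ m, ‖p m‖ ≤ anC d R ^ m * M := by
    intro m
    refine le_of_tendsto (hp m).norm (Eventually.of_forall fun n => ?_)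
    have hf : (0:ℝ) < m.factorial := by positivity
    rw [norm_smul, norm_inv, Real.norm_natCast, inv_mul_le_iff₀ hf]
    have := deriv_bound (hh n) hR (h0 n) (hM n) hmem m
    linarith
  have hT : ∀ y : EuclideanSpace ℝ (Fin d), ‖y‖ ≤ R / 4 → ∀ N : ℕ,
      |u (x₀ + y) - ∑ k ∈ Finset.range (N + 1), p k (fun _ => y)|
      ≤ M * ((N + 1 : ℕ) * (anC d R * ‖y‖) ^ (N + 1)) := by
    intro y hy N
    have hyb : x₀ + y ∈ ball x₀ R := by
      rw [mem_ball, dist_eq_norm, add_sub_cancel_left]; linarith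
    have l1 : Tendsto (fun n => h n (x₀ + y)) atTop (𝓝 (u (x₀ + y))) := hlim.tendsto_at hyb
    have l2 : Tendsto (fun n => ∑ k ∈ Finset.range (N + 1),
        ((k.factorial : ℝ)⁻¹ • iteratedFDeriv ℝ k (h n) x₀) (fun _ => y)) atTop
        (𝓝 (∑ k ∈ Finset.range (N + 1), p k (fun _ => y))) := by
      apply tendsto_finsetSum
      intro k _
      exact ((ContinuousMultilinearMap.apply ℝ (fun _ : Fin k => EuclideanSpace ℝ (Fin d)) ℝ
        (fun _ => y)).continuous.tendsto (p k)).comp (hp k)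
    exact le_of_tendsto (l1.sub l2).abs
      (Eventually.of_forall fun n => taylor_bound (hh n) hR (h0 n) (hM n) hy N)
  set r : NNReal := ⟨min (R / 4) (1 / (2 * anC d R)), by positivity⟩ with hr
  have hr0 : 0 < r := by
    rw [← NNReal.coe_pos]; change (0:ℝ) < min (R / 4) (1 / (2 * anC d R)); positivity
  have hr1 : (r : ℝ) ≤ R / 4 := min_le_left _ _
  have hr2 : anC d R * r ≤ 1 / 2 := by
    have : (r : ℝ) ≤ 1 / (2 * anC d R) := min_le_right _ _
    calc _ ≤ anC d R * (1 / (2 * anC d R)) := by gcongr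
      _ = _ := by field_simp
  let P : FormalMultilinearSeries ℝ (EuclideanSpace ℝ (Fin d)) ℝ := p
  have hball : HasFPowerSeriesOnBall u P x₀ r := by
    refine ⟨?_, by exact_mod_cast hr0, ?_⟩
    · apply FormalMultilinearSeries.le_radius_of_bound (C := M)
      intro n
      calc ‖p n‖ * (r:ℝ) ^ n ≤ (anC d R ^ n * M) * (r:ℝ) ^ n := by gcongr; exact hpn n
        _ = M * (anC d R * r) ^ n := by rw [mul_pow]; ring
        _ ≤ M * 1 := by
          gcongr
          exact pow_le_one₀ (by positivity) (by linarith)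
        _ = M := mul_one M
    · intro y hy
      have hyr : ‖y‖ < r := by
        rw [Metric.mem_eball, edist_zero_right] at hy
        exact_mod_cast hy
      have hq : anC d R * ‖y‖ ≤ 1 / 2 :=
        (mul_le_mul_of_nonneg_left hyr.le hA.le).trans hr2
      have hq0 : 0 ≤ anC d R * ‖y‖ := by positivity
      have hsum : Summable (fun n => P n (fun _ => y)) := by
        refine Summable.of_norm_bounded (g := fun n => M * (anC d R * ‖y‖) ^ n)
          ((summable_geometric_of_lt_one hq0 (by linarith)).mul_left M) fun n => ?_
        have := (p n).le_opNorm (fun _ => y)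
        calc _ ≤ ‖p n‖ * ∏ _i : Fin n, ‖y‖ := this
          _ ≤ (anC d R ^ n * M) * ∏ _i : Fin n, ‖y‖ := by gcongr; exact hpn n
          _ = _ := by simp [mul_pow]; ring
      rw [hsum.hasSum_iff_tendsto_nat, ← tendsto_add_atTop_iff_nat 1]
      rw [tendsto_iff_norm_sub_tendsto_zero]
      have hz : Tendsto (fun N : ℕ => M * ((N + 1 : ℕ) * (anC d R * ‖y‖) ^ (N + 1))) atTop (𝓝 0) := by
        have := (tendsto_self_mul_const_pow_of_lt_one hq0 (by linarith : anC d R * ‖y‖ < 1))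
        have := ((tendsto_add_atTop_iff_nat 1).2 this).const_mul M
        simpa using this
      refine squeeze_zero (fun _ => norm_nonneg _) (fun N => ?_) hz
      rw [norm_sub_rev, Real.norm_eq_abs]
      exact hT y (hyr.le.trans hr1) N
  exact hball.analyticAt

lemma dd_conv {d : ℕ} {φ f : EuclideanSpace ℝ (Fin d) → ℝ} (hφ : LocallyIntegrable φ volume)
    (hf : ContDiff ℝ 1 f) (hc : HasCompactSupport f) (v : EuclideanSpace ℝ (Fin d)) :
    dd v (φ ⋆[ContinuousLinearMap.lsmul ℝ ℝ, volume] f) =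
      φ ⋆[ContinuousLinearMap.lsmul ℝ ℝ, volume] (dd v f) := by
  ext x
  have h := hc.hasFDerivAt_convolution_right (ContinuousLinearMap.lsmul ℝ ℝ) hφ hf x
  unfold dd
  rw [h.fderiv]
  exact convolution_precompR_apply (L := ContinuousLinearMap.lsmul ℝ ℝ) hφ (hc.fderiv ℝ)
    (hf.continuous_fderiv one_ne_zero) x v

lemma dd_contDiff' {d : ℕ} (v : EuclideanSpace ℝ (Fin d)) {h : EuclideanSpace ℝ (Fin d) → ℝ}
    {n : ℕ} (hh : ContDiff ℝ (n + 1 : ℕ) h) : ContDiff ℝ n (dd v h) := by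
  unfold dd
  exact (hh.fderiv_right (m := n) (by norm_cast)).clm_apply contDiff_const

lemma dd_compact {d : ℕ} (v : EuclideanSpace ℝ (Fin d)) {h : EuclideanSpace ℝ (Fin d) → ℝ}
    (hh : HasCompactSupport h) : HasCompactSupport (dd v h) := by
  unfold dd
  exact (hh.fderiv ℝ).comp_left (g := fun L : EuclideanSpace ℝ (Fin d) →L[ℝ] ℝ => L v) (by simp)

lemma lap_conv {d : ℕ} {φ f : EuclideanSpace ℝ (Fin d) → ℝ} (hφ : LocallyIntegrable φ volume)
    (hf : ContDiff ℝ 2 f) (hc : HasCompactSupport f) {x : EuclideanSpace ℝ (Fin d)} {R : ℝ}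
    (hs : Function.support φ ⊆ ball 0 R) (h0 : ∀ y ∈ ball x R, lap f y = 0) :
    lap (φ ⋆[ContinuousLinearMap.lsmul ℝ ℝ, volume] f) x = 0 := by
  have h1 : ∀ i : Fin d, ContDiff ℝ 1 (dd (EuclideanSpace.single i 1) f) :=
    fun i => dd_contDiff' (n := 1) _ hf
  have h2 : ∀ i : Fin d, ContDiff ℝ 0
      (dd (EuclideanSpace.single i 1) (dd (EuclideanSpace.single i 1) f)) :=
    fun i => dd_contDiff' (n := 0) _ (h1 i)
  have hc2 : ∀ i : Fin d, HasCompactSupport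
      (dd (EuclideanSpace.single i 1) (dd (EuclideanSpace.single i 1) f)) :=
    fun i => dd_compact _ (dd_compact _ hc)
  rw [lap_eq]
  have : ∀ i : Fin d, dd (EuclideanSpace.single i 1) (dd (EuclideanSpace.single i 1)
      (φ ⋆[ContinuousLinearMap.lsmul ℝ ℝ, volume] f)) x =
      ∫ t, φ t * dd (EuclideanSpace.single i 1) (dd (EuclideanSpace.single i 1) f) (x - t) := by
    intro i
    rw [dd_conv hφ (hf.of_le (by norm_num)) hc, dd_conv hφ (h1 i) (dd_compact _ hc)]
    simp [convolution]
  simp_rw [this]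
  rw [← integral_finsetSum]
  · simp_rw [← Finset.mul_sum, ← lap_eq]
    apply integral_eq_zero_of_ae
    refine Eventually.of_forall fun t => ?_
    by_cases ht : φ t = 0
    · simp [ht]
    · have hm : t ∈ ball (0 : EuclideanSpace ℝ (Fin d)) R := hs ht
      have : lap f (x - t) = 0 := h0 _ (by
        rw [mem_ball, dist_eq_norm]; simpa using hm)
      simp [this]
  · intro i _
    have := (hc2 i).convolutionExists_right (ContinuousLinearMap.lsmul ℝ ℝ) hφ (h2 i).continuous x
    simpa [ConvolutionExistsAt] using this

lemma harmonic_analyticAt {d : ℕ} {u : EuclideanSpace ℝ (Fin d) → ℝ}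
    (hu : HarmonicOn u (ball 0 1)) {x₀ : EuclideanSpace ℝ (Fin d)} (hx₀ : x₀ ∈ ball 0 1) :
    AnalyticAt ℝ u x₀ := by
  obtain ⟨hu2, hu0⟩ := hu
  have hδ : 0 < 1 - ‖x₀‖ := by rw [mem_ball_zero_iff] at hx₀; linarith
  set δ := 1 - ‖x₀‖ with hδdef
  let χ : ContDiffBump x₀ := ⟨δ / 2, 3 * δ / 4, by positivity, by linarith⟩
  have hcb : closedBall x₀ (3 * δ / 4) ⊆ ball 0 1 := by
    intro y hy
    rw [mem_closedBall, dist_eq_norm] at hy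
    rw [mem_ball_zero_iff]
    have : ‖y‖ ≤ ‖y - x₀‖ + ‖x₀‖ := by simpa using norm_add_le (y - x₀) x₀
    linarith
  set f : EuclideanSpace ℝ (Fin d) → ℝ := fun y => χ y * u y with hf
  have hfc : HasCompactSupport f := χ.hasCompactSupport.mul_right
  have hts : tsupport f ⊆ closedBall x₀ (3 * δ / 4) := by
    refine (tsupport_mul_subset_left).trans ?_
    rw [χ.tsupport_eq]
  have hf2 : ContDiff ℝ 2 f := by
    rw [contDiff_iff_contDiffAt]
    intro y
    by_cases hy : y ∈ tsupport f
    · have hyb := hcb (hts hy)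
      exact χ.contDiff.contDiffAt.mul ((hu2 y hyb).contDiffAt (isOpen_ball.mem_nhds hyb))
    · have : f =ᶠ[𝓝 y] fun _ => 0 := notMem_tsupport_iff_eventuallyEq.1 hy
      exact contDiffAt_const.congr_of_eventuallyEq this
  have hfu : ∀ y ∈ ball x₀ (δ / 2), f y = u y := by
    intro y hy
    simp [hf, χ.one_of_mem_closedBall (ball_subset_closedBall hy)]
  have hlapf : ∀ y ∈ ball x₀ (δ / 2), lap f y = 0 := by
    intro y hy
    have hyb : y ∈ ball (0 : EuclideanSpace ℝ (Fin d)) 1 :=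
      hcb (ball_subset_closedBall (ball_subset_ball (by linarith) hy))
    rw [← hu0 y hyb]
    have he : f =ᶠ[𝓝 y] u := by
      filter_upwards [isOpen_ball.mem_nhds hy] with z hz using hfu z hz
    have he2 := he.fderiv (𝕜 := ℝ)
    unfold lap
    refine Finset.sum_congr rfl fun i _ => ?_
    have : (fun y => fderiv ℝ f y (EuclideanSpace.single i 1)) =ᶠ[𝓝 y]
      (fun y => fderiv ℝ u y (EuclideanSpace.single i 1)) := by
      filter_upwards [he2] with z hz
      rw [hz]
    rw [this.fderiv_eq]
  have hR : 0 < δ / 4 := by positivity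
  let φ : ℕ → ContDiffBump (0 : EuclideanSpace ℝ (Fin d)) := fun n =>
    ⟨δ / 4 / (n + 2), δ / 4 / (n + 1), by positivity, by gcongr; norm_num⟩
  have hrout : ∀ n, (φ n).rOut = δ / 4 / (n + 1) := fun n => rfl
  have hφl : ∀ n, LocallyIntegrable ((φ n).normed volume) volume := fun n =>
    (φ n).continuous_normed.locallyIntegrable
  let h : ℕ → EuclideanSpace ℝ (Fin d) → ℝ := fun n =>
    (φ n).normed volume ⋆[ContinuousLinearMap.lsmul ℝ ℝ, volume] f
  have hle : ∀ n, (φ n).rOut ≤ δ / 4 := by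
    intro n
    rw [hrout]
    apply div_le_self hR.le
    have : (0:ℝ) ≤ n := by positivity
    linarith
  obtain ⟨B, hB⟩ := hfc.exists_bound_of_continuous hf2.continuous
  have hball2 : ball x₀ (δ / 4) ⊆ ball x₀ (δ / 2) := ball_subset_ball (by linarith)
  refine analytic_of_approx (h := h) (R := δ / 4) (M := 3 * B) ?_ hR ?_ ?_ ?_
  · intro n
    exact (φ n).hasCompactSupport_normed.contDiff_convolution_left (n := ⊤) _
      (φ n).contDiff_normed hf2.continuous.locallyIntegrable
  · intro n y hy
    refine lap_conv (R := δ / 4) (hφl n) hf2 hfc ?_ ?_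
    · rw [(φ n).support_normed_eq]
      exact ball_subset_ball (hle n)
    · intro z hz
      apply hlapf
      rw [mem_ball] at *
      linarith [dist_triangle z y x₀]
  · intro n y hy
    have h1 : dist (h n y) (f y) ≤ 2 * B := by
      apply (φ n).dist_normed_convolution_le hf2.continuous.aestronglyMeasurable
      intro z _
      rw [dist_eq_norm]
      linarith [norm_sub_le (f z) (f y), hB z, hB y]
    rw [Real.dist_eq] at h1
    have h2 := hB y
    rw [Real.norm_eq_abs] at h2
    have h3 : |h n y| ≤ |h n y - f y| + |f y| := by simpa using abs_add_le (h n y - f y) (f y)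
    linarith
  · rw [Metric.tendstoUniformlyOn_iff]
    intro ε hε
    have huc : UniformContinuous f := hfc.uniformContinuous_of_continuous hf2.continuous
    rw [Metric.uniformContinuous_iff] at huc
    obtain ⟨η, hη, hηf⟩ := huc (ε / 2) (by positivity)
    have ht : Tendsto (fun n : ℕ => δ / 4 / ((n:ℝ) + 1)) atTop (𝓝 0) := by
      have := (tendsto_one_div_add_atTop_nhds_zero_nat (𝕜 := ℝ)).const_mul (δ / 4)
      simpa [div_eq_mul_inv] using this
    filter_upwards [ht.eventually (gt_mem_nhds hη)] with n hn y hy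
    rw [← hfu y (hball2 hy), dist_comm]
    refine lt_of_le_of_lt ((φ n).dist_normed_convolution_le (ε := ε / 2)
      hf2.continuous.aestronglyMeasurable ?_) (by linarith)
    intro z hz
    exact (hηf (lt_trans (mem_ball.1 hz) (by rw [hrout]; exact hn))).le

section Haus
variable {d : ℕ}

/-- local graph parametrization of the unit sphere over the tangent space -/
def graphMap (x : EuclideanSpace ℝ (Fin d)) (y : (Submodule.span ℝ {x})ᗮ) :
    EuclideanSpace ℝ (Fin d) := (y : EuclideanSpace ℝ (Fin d)) + √(1 - ‖y‖ ^ 2) • x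

lemma graphMap_contDiffAt (x : EuclideanSpace ℝ (Fin d)) : ContDiffAt ℝ 1 (graphMap x) 0 := by
  unfold graphMap
  have h1 : ContDiffAt ℝ 1 (fun y : (Submodule.span ℝ {x})ᗮ => √(1 - ‖y‖ ^ 2)) 0 := by
    apply ContDiffAt.sqrt
    · exact contDiffAt_const.sub (contDiff_norm_sq ℝ).contDiffAt
    · simp
  exact ((Submodule.span ℝ {x})ᗮ.subtypeL.contDiff.contDiffAt).add (h1.smul contDiffAt_const)

lemma finrank_perp {x : EuclideanSpace ℝ (Fin d)} (hx : ‖x‖ = 1) :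
    ((Module.finrank ℝ (Submodule.span ℝ {x})ᗮ : ℕ) : ℝ) = (d : ℝ) - 1 := by
  have hx0 : x ≠ 0 := by rintro rfl; simp at hx
  have h1 := Submodule.finrank_add_finrank_orthogonal (Submodule.span ℝ {x})
  rw [finrank_span_singleton hx0, finrank_euclideanSpace_fin] at h1
  have h2 : (1:ℝ) + (Module.finrank ℝ (Submodule.span ℝ {x})ᗮ : ℝ) = d := by exact_mod_cast h1
  linarith

lemma inner_perp (x : EuclideanSpace ℝ (Fin d)) (y : (Submodule.span ℝ {x})ᗮ) :
    inner ℝ (y : EuclideanSpace ℝ (Fin d)) x = 0 :=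
  Submodule.inner_left_of_mem_orthogonal (Submodule.mem_span_singleton_self x) y.2

lemma graphMap_mem {x : EuclideanSpace ℝ (Fin d)} (hx : ‖x‖ = 1)
    {y : (Submodule.span ℝ {x})ᗮ} (hy : ‖y‖ ≤ 1) : ‖graphMap x y‖ = 1 := by
  have h : ‖graphMap x y‖ ^ 2 = 1 := by
    unfold graphMap
    rw [norm_add_sq_real, inner_smul_right, inner_perp, norm_smul, hx, Real.norm_eq_abs, mul_one,
      sq_abs, Real.sq_sqrt (by nlinarith [norm_nonneg y])]
    simp
  nlinarith [norm_nonneg (graphMap x y)]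

lemma proj_graphMap (x : EuclideanSpace ℝ (Fin d)) (y : (Submodule.span ℝ {x})ᗮ) :
    (Submodule.span ℝ {x})ᗮ.orthogonalProjectionOnto (graphMap x y) = y := by
  unfold graphMap
  rw [map_add, map_smul, Submodule.orthogonalProjectionOnto_mem_subspace_eq_self]
  rw [Submodule.orthogonalProjectionOnto_orthogonalComplement_singleton_eq_zero]
  simp

lemma graphMap_proj {x z : EuclideanSpace ℝ (Fin d)} (hx : ‖x‖ = 1) (hz : ‖z‖ = 1)
    (hp : 0 ≤ inner ℝ x z) :
    graphMap x ((Submodule.span ℝ {x})ᗮ.orthogonalProjectionOnto z) = z := by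
  have hdec : ((Submodule.span ℝ {x})ᗮ.orthogonalProjectionOnto z : EuclideanSpace ℝ (Fin d))
      + inner ℝ x z • x = z := by
    have h1 := Submodule.starProjection_add_starProjection_orthogonal (K := Submodule.span ℝ {x}) z
    rw [Submodule.starProjection_unit_singleton ℝ hx] at h1
    rw [add_comm]
    exact h1
  unfold graphMap
  set y := (Submodule.span ℝ {x})ᗮ.orthogonalProjectionOnto z with hy
  have hn : ‖z‖ ^ 2 = ‖y‖ ^ 2 + (inner ℝ x z) ^ 2 := by
    conv_lhs => rw [← hdec]
    rw [norm_add_sq_real, inner_smul_right, inner_perp, norm_smul, hx, Real.norm_eq_abs, mul_one,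
      sq_abs]
    simp
  have : √(1 - ‖y‖ ^ 2) = inner ℝ x z := by
    rw [hz] at hn
    rw [show 1 - ‖y‖ ^ 2 = (inner ℝ x z) ^ 2 by linarith, Real.sqrt_sq hp]
  rw [this, hdec]

lemma sphere_finite (hd : 1 ≤ d) :
    μH[((d : ℝ) - 1)] (sphere (0 : EuclideanSpace ℝ (Fin d)) 1) < ⊤ := by
  have hd0 : (0:ℝ) ≤ (d:ℝ) - 1 := by
    have : (1:ℝ) ≤ d := by exact_mod_cast hd
    linarith
  apply (isCompact_sphere _ _).measure_lt_top_of_nhdsWithin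
  intro x hx
  have hx1 : ‖x‖ = 1 := by simpa using hx
  obtain ⟨C, t, ht, hL⟩ := (graphMap_contDiffAt x).exists_lipschitzOnWith
  obtain ⟨ε, hε, hεt⟩ := Metric.nhds_basis_closedBall.mem_iff.1 ht
  set K := (Submodule.span ℝ {x})ᗮ
  refine ⟨graphMap x '' (closedBall 0 ε), ?_, ?_⟩
  · have hc1 : ContinuousAt (fun z : EuclideanSpace ℝ (Fin d) => K.orthogonalProjectionOnto z) x := by
      fun_prop
    have hc2 : ContinuousAt (fun z : EuclideanSpace ℝ (Fin d) => inner ℝ x z) x := by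
      fun_prop
    have hz0 : K.orthogonalProjectionOnto x = 0 :=
      Submodule.orthogonalProjectionOnto_orthogonalComplement_singleton_eq_zero x
    have e1 : ∀ᶠ z in 𝓝 x, K.orthogonalProjectionOnto z ∈ closedBall (0 : K) ε := by
      apply hc1
      change closedBall (0 : K) ε ∈ 𝓝 (K.orthogonalProjectionOnto x)
      rw [hz0]
      exact closedBall_mem_nhds _ hε
    have e2 : ∀ᶠ z in 𝓝 x, 0 < inner ℝ x z := by
      apply hc2.eventually (lt_mem_nhds _)
      simp [hx1]
    filter_upwards [self_mem_nhdsWithin, mem_nhdsWithin_of_mem_nhds e1,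
      mem_nhdsWithin_of_mem_nhds e2] with z hz h1 h2
    exact ⟨_, h1, graphMap_proj hx1 (by simpa using hz) (le_of_lt h2)⟩
  · refine ((hL.mono hεt).hausdorffMeasure_image_le hd0).trans_lt ?_
    apply ENNReal.mul_lt_top
    · exact ENNReal.rpow_lt_top_of_nonneg hd0 ENNReal.coe_ne_top
    · rw [← finrank_perp hx1]
      exact (isCompact_closedBall _ _).measure_lt_top

lemma sphere_open_pos (hd : 1 ≤ d) {x : EuclideanSpace ℝ (Fin d)} (hx : ‖x‖ = 1)
    {O : Set (EuclideanSpace ℝ (Fin d))} (hO : O ∈ 𝓝 x) :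
    0 < μH[((d : ℝ) - 1)] (O ∩ sphere (0 : EuclideanSpace ℝ (Fin d)) 1) := by
  have hd0 : (0:ℝ) ≤ (d:ℝ) - 1 := by
    have : (1:ℝ) ≤ d := by exact_mod_cast hd
    linarith
  set K := (Submodule.span ℝ {x})ᗮ
  have h0 : graphMap x 0 = x := by simp [graphMap]
  have hc := (graphMap_contDiffAt x).continuousAt
  have e1 : ∀ᶠ y in 𝓝 (0 : K), graphMap x y ∈ O := by
    apply hc
    rw [h0]; exact hO
  obtain ⟨ε, hε, hεt⟩ := Metric.mem_nhds_iff.1 (inter_mem e1 (ball_mem_nhds (0 : K) one_pos))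
  refine lt_of_lt_of_le ?_ (hausdorffMeasure_orthogonalProjectionOnto_le K ((d:ℝ) - 1) _ hd0)
  refine lt_of_lt_of_le (b := μH[((d : ℝ) - 1)] (ball (0 : K) ε)) ?_ (measure_mono ?_)
  · rw [← finrank_perp hx]
    exact isOpen_ball.measure_pos _ ⟨0, mem_ball_self hε⟩
  · intro y hy
    obtain ⟨h1, h2⟩ := hεt hy
    refine ⟨graphMap x y, ⟨h1, ?_⟩, proj_graphMap x y⟩
    rw [mem_sphere_zero_iff_norm]
    exact graphMap_mem hx (le_of_lt (by simpa using h2))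

end Haus

section Fin
variable {d : ℕ}

lemma restrict_sphere_eq (hd : 1 ≤ d) {r : ℝ} (hr : 0 < r) :
    (μH[((d : ℝ) - 1)]).restrict (sphere (0 : EuclideanSpace ℝ (Fin d)) r) =
      (‖r‖₊ ^ ((d : ℝ) - 1)) • Measure.map (fun x => r • x)
        ((μH[((d : ℝ) - 1)]).restrict (sphere (0 : EuclideanSpace ℝ (Fin d)) 1)) := by
  have hd0 : (0:ℝ) ≤ (d:ℝ) - 1 := by
    have : (1:ℝ) ≤ d := by exact_mod_cast hd
    linarith
  have hm : Measurable (fun x : EuclideanSpace ℝ (Fin d) => r • x) :=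
    (continuous_const_smul r).measurable
  ext s hs
  rw [Measure.restrict_apply hs, Measure.smul_apply, Measure.map_apply hm hs,
    Measure.restrict_apply (hm hs), ← Measure.hausdorffMeasure_smul₀ hd0 hr.ne']
  congr 1
  ext x
  constructor
  · rintro ⟨h1, h2⟩
    refine ⟨r⁻¹ • x, ⟨?_, ?_⟩, ?_⟩
    · simpa [smul_smul, hr.ne'] using h1
    · have : ‖x‖ = r := by simpa using h2
      rw [mem_sphere_zero_iff_norm, norm_smul, this, Real.norm_eq_abs, abs_of_pos (inv_pos.2 hr),
        inv_mul_cancel₀ hr.ne']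
    · simp [smul_smul, hr.ne']
  · rintro ⟨y, ⟨h1, h2⟩, rfl⟩
    refine ⟨h1, ?_⟩
    have : ‖y‖ = 1 := by simpa using h2
    rw [mem_sphere_zero_iff_norm]
    simp only [norm_smul, this, Real.norm_eq_abs, abs_of_pos hr, mul_one]

lemma average_sphere_eq (hd : 1 ≤ d) {r : ℝ} (hr : 0 < r) (f : EuclideanSpace ℝ (Fin d) → ℝ) :
    ⨍ x in sphere (0 : EuclideanSpace ℝ (Fin d)) r, f x ∂μH[((d : ℝ) - 1)] =
    ⨍ x in sphere (0 : EuclideanSpace ℝ (Fin d)) 1, f (r • x) ∂μH[((d : ℝ) - 1)] := by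
  have hme : MeasurableEmbedding (fun x : EuclideanSpace ℝ (Fin d) => r • x) :=
    (Homeomorph.smulOfNeZero r hr.ne').measurableEmbedding
  have hc : (‖r‖₊ ^ ((d : ℝ) - 1)) ≠ 0 := by
    apply (NNReal.rpow_pos (by simpa using hr.ne')).ne'
  rw [restrict_sphere_eq hd hr]
  set c := (‖r‖₊ ^ ((d : ℝ) - 1))
  rw [average_eq, average_eq, integral_smul_nnreal_measure, hme.integral_map,
    measureReal_nnreal_smul_apply, map_measureReal_apply hme.measurable MeasurableSet.univ,
    preimage_univ]
  have hc' : (c:ℝ) ≠ 0 := by exact_mod_cast hc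
  simp only [smul_eq_mul, NNReal.smul_def]
  rw [mul_inv]
  field_simp

lemma exists_order {u : EuclideanSpace ℝ (Fin d) → ℝ} (hu : AnalyticOnNhd ℝ u (ball 0 1))
    (hnz : ∃ x ∈ ball (0 : EuclideanSpace ℝ (Fin d)) 1, u x ≠ 0) :
    ∃ k : ℕ, iteratedFDeriv ℝ k u 0 ≠ 0 := by
  by_contra! h
  obtain ⟨p, r, hp⟩ := hu 0 (mem_ball_self one_pos)
  have h0 : u =ᶠ[𝓝 0] 0 := by
    filter_upwards [Metric.eball_mem_nhds (0 : EuclideanSpace ℝ (Fin d)) hp.r_pos] with y hy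
    have h1 := hp.hasSum_iteratedFDeriv hy
    simp only [h, zero_add] at h1
    simpa using h1.unique (by simpa using hasSum_zero)
  obtain ⟨x, hx, hne⟩ := hnz
  exact hne (hu.eqOn_zero_of_preconnected_of_eventuallyEq_zero
    (convex_ball _ _).isPreconnected (mem_ball_self one_pos) h0 hx)

lemma diag_ne_zero {u : EuclideanSpace ℝ (Fin d) → ℝ}
    {p : FormalMultilinearSeries ℝ (EuclideanSpace ℝ (Fin d)) ℝ} {r : ℝ≥0∞}
    (hp : HasFPowerSeriesOnBall u p (0 : EuclideanSpace ℝ (Fin d)) r) {k : ℕ}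
    (hk : iteratedFDeriv ℝ k u 0 ≠ 0) : ∃ y, p k (fun _ => y) ≠ 0 := by
  by_contra! h
  apply hk
  ext v
  have h1 := hp.iteratedFDeriv_eq_sum_of_completeSpace v
  rw [h1, ← (p k).iteratedFDeriv_comp_diagonal 0 v]
  have : (fun x => p k (fun _ => x)) = fun _ => (0:ℝ) := funext h
  rw [this]
  simp

lemma diag_smul (p : FormalMultilinearSeries ℝ (EuclideanSpace ℝ (Fin d)) ℝ) (k : ℕ) (t : ℝ)
    (y : EuclideanSpace ℝ (Fin d)) : p k (fun _ => t • y) = t ^ k * p k (fun _ => y) := by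
  have := (p k).map_smul_univ (fun _ => t) (fun _ => y)
  simpa using this

lemma diag_sphere (hd : 1 ≤ d) {p : FormalMultilinearSeries ℝ (EuclideanSpace ℝ (Fin d)) ℝ} {k : ℕ}
    (h : ∃ y, p k (fun _ => y) ≠ 0) :
    ∃ y : EuclideanSpace ℝ (Fin d), ‖y‖ = 1 ∧ p k (fun _ => y) ≠ 0 := by
  obtain ⟨y, hy⟩ := h
  by_cases hy0 : y = 0
  · have hk : k = 0 := by
      by_contra hk
      apply hy
      have := diag_smul p k 0 y
      rw [zero_pow hk, zero_mul, zero_smul] at this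
      rw [hy0]; exact this
    subst hk
    refine ⟨EuclideanSpace.single ⟨0, hd⟩ 1, by simp, ?_⟩
    convert hy
  · have hn : ‖y‖ ≠ 0 := norm_ne_zero_iff.2 hy0
    refine ⟨‖y‖⁻¹ • y, ?_, ?_⟩
    · rw [norm_smul, norm_inv, norm_norm, inv_mul_cancel₀ hn]
    · rw [diag_smul]
      exact mul_ne_zero (pow_ne_zero _ (inv_ne_zero hn)) hy

/-- blow-up estimate -/
lemma blowup {u : EuclideanSpace ℝ (Fin d) → ℝ}
    {p : FormalMultilinearSeries ℝ (EuclideanSpace ℝ (Fin d)) ℝ} {r : ℝ≥0∞}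
    (hp : HasFPowerSeriesOnBall u p (0 : EuclideanSpace ℝ (Fin d)) r) {k : ℕ}
    (hk : ∀ j < k, iteratedFDeriv ℝ j u 0 = 0) :
    ∃ C : ℝ, ∃ δ > 0, ∀ y : EuclideanSpace ℝ (Fin d), ‖y‖ < δ →
      |u y - p k (fun _ => y)| ≤ C * ‖y‖ ^ (k + 1) := by
  have h := hp.hasFPowerSeriesAt.isBigO_sub_partialSum_pow (k + 1)
  obtain ⟨C, hC⟩ := h.bound
  obtain ⟨δ, hδ, hb⟩ := Metric.eventually_nhds_iff.1 hC
  refine ⟨C, δ, hδ, fun y hy => ?_⟩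
  have h1 := hb (by simpa using hy)
  have h2 : p.partialSum (k + 1) y = p k (fun _ => y) := by
    rw [FormalMultilinearSeries.partialSum, Finset.sum_range_succ, Finset.sum_eq_zero, zero_add]
    intro j hj
    have h3 := hp.factorial_smul y j
    rw [hk j (Finset.mem_range.1 hj)] at h3
    simpa [Nat.factorial_ne_zero] using h3
  rw [h2, zero_add, norm_pow, norm_norm, Real.norm_eq_abs] at h1
  exact h1

lemma tendsto_F (hd : 1 ≤ d) {u P : EuclideanSpace ℝ (Fin d) → ℝ} {k : ℕ}
    (hu : ContinuousOn u (ball 0 1)) (hP : Continuous P)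
    (hPk : ∀ (t : ℝ) y, P (t • y) = t ^ k * P y) {C δ : ℝ} (hδ : 0 < δ)
    (hb : ∀ y, ‖y‖ < δ → |u y - P y| ≤ C * ‖y‖ ^ (k + 1)) :
    Tendsto (fun r : ℝ => ∫ x in sphere (0 : EuclideanSpace ℝ (Fin d)) 1,
        (u (r • x) / r ^ k) ^ 2 ∂μH[((d : ℝ) - 1)]) (𝓝[>] 0)
      (𝓝 (∫ x in sphere (0 : EuclideanSpace ℝ (Fin d)) 1, (P x) ^ 2 ∂μH[((d : ℝ) - 1)])) := by
  have hfin : Fact (μH[((d : ℝ) - 1)] (sphere (0 : EuclideanSpace ℝ (Fin d)) 1) < ⊤) :=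
    ⟨sphere_finite hd⟩
  obtain ⟨M, hM⟩ := (isCompact_sphere (0 : EuclideanSpace ℝ (Fin d)) 1).exists_bound_of_continuousOn
    hP.continuousOn
  have key : ∀ r : ℝ, 0 < r → r < δ → ∀ x ∈ sphere (0 : EuclideanSpace ℝ (Fin d)) 1,
      |u (r • x) / r ^ k - P x| ≤ C * r := by
    intro r hr hrδ x hx
    have hx1 : ‖x‖ = 1 := by simpa using hx
    have hn : ‖r • x‖ = r := by rw [norm_smul, hx1, Real.norm_eq_abs, abs_of_pos hr, mul_one]
    have h1 := hb (r • x) (by rw [hn]; exact hrδ)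
    rw [hn, hPk] at h1
    have hrk : 0 < r ^ k := by positivity
    have h2 : u (r • x) / r ^ k - P x = (u (r • x) - r ^ k * P x) / r ^ k := by
      field_simp
    rw [h2, abs_div, abs_of_pos hrk, div_le_iff₀ hrk]
    calc _ ≤ _ := h1
      _ = _ := by ring
  have small : ∀ᶠ r : ℝ in 𝓝[>] 0, 0 < r ∧ r < δ ∧ r < 1 := by
    filter_upwards [Ioo_mem_nhdsGT (lt_min hδ one_pos)] with r hr
    exact ⟨hr.1, hr.2.trans_le (min_le_left _ _), hr.2.trans_le (min_le_right _ _)⟩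
  refine tendsto_integral_filter_of_dominated_convergence (fun _ => (|C| + M) ^ 2) ?_ ?_ ?_ ?_
  · filter_upwards [small] with r ⟨h1, h2, h3⟩
    apply ContinuousOn.aestronglyMeasurable _ isClosed_sphere.measurableSet
    apply ContinuousOn.pow
    apply ContinuousOn.div_const
    apply hu.comp (continuous_const_smul r).continuousOn
    intro x hx
    have hx1 : ‖x‖ = 1 := by simpa using hx
    simp only [mem_ball_zero_iff, norm_smul, hx1, Real.norm_eq_abs, abs_of_pos h1, mul_one, h3]
  · filter_upwards [small] with r ⟨h1, h2, h3⟩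
    filter_upwards [ae_restrict_mem isClosed_sphere.measurableSet] with x hx
    rw [norm_pow, Real.norm_eq_abs]
    have h4 := key r h1 h2 x hx
    have h5 := hM x hx
    rw [Real.norm_eq_abs] at h5
    have h6 : C * r ≤ |C| := by nlinarith [le_abs_self C, abs_nonneg C]
    have h7 : |u (r • x) / r ^ k| ≤ |C| + M := by
      have := abs_add_le (u (r • x) / r ^ k - P x) (P x)
      rw [sub_add_cancel] at this
      linarith
    exact pow_le_pow_left₀ (abs_nonneg _) h7 2
  · exact integrable_const _
  · filter_upwards [ae_restrict_mem isClosed_sphere.measurableSet] with x hx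
    apply Filter.Tendsto.pow
    rw [tendsto_iff_norm_sub_tendsto_zero]
    have hz : Tendsto (fun r : ℝ => C * r) (𝓝[>] 0) (𝓝 0) := by
      have : Tendsto (fun r : ℝ => C * r) (𝓝 0) (𝓝 (C * 0)) := by
        apply Continuous.tendsto; fun_prop
      rw [mul_zero] at this
      exact this.mono_left nhdsWithin_le_nhds
    refine squeeze_zero' (Eventually.of_forall fun _ => norm_nonneg _) ?_ hz
    filter_upwards [small] with r ⟨h1, h2, h3⟩
    exact key r h1 h2 x hx

lemma integral_pos_of_ne (hd : 1 ≤ d) {P : EuclideanSpace ℝ (Fin d) → ℝ} (hP : Continuous P)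
    {y : EuclideanSpace ℝ (Fin d)} (hy : ‖y‖ = 1) (hPy : P y ≠ 0) :
    0 < ∫ x in sphere (0 : EuclideanSpace ℝ (Fin d)) 1, (P x) ^ 2 ∂μH[((d : ℝ) - 1)] := by
  have hfin : Fact (μH[((d : ℝ) - 1)] (sphere (0 : EuclideanSpace ℝ (Fin d)) 1) < ⊤) :=
    ⟨sphere_finite hd⟩
  obtain ⟨M, hM⟩ := (isCompact_sphere (0 : EuclideanSpace ℝ (Fin d)) 1).exists_bound_of_continuousOn
    (hP.pow 2).continuousOn
  rw [setIntegral_pos_iff_support_of_nonneg_ae]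
  · have ho : IsOpen (Function.support fun x => P x ^ 2) :=
      isOpen_ne_fun (hP.pow 2) continuous_const
    exact sphere_open_pos hd hy (ho.mem_nhds (by simpa using hPy))
  · exact Eventually.of_forall fun x => sq_nonneg _
  · refine Measure.integrableOn_of_bounded hfin.out.ne (hP.pow 2).aestronglyMeasurable (M := M) ?_
    filter_upwards [ae_restrict_mem isClosed_sphere.measurableSet] with x hx
    exact hM x hx

end Fin

end Helpers

/-- **Convergence of the doubling index to the vanishing order.**  If `u` is harmonic in
`B_1 ⊂ ℝ^d` and not identically zero, then the doubling index `N(r)` converges as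
`r → 0` to a nonnegative integer `k`, which is the vanishing order of `u` at `0`: the
degree of the first nonvanishing term of the Taylor expansion of `u` at `0`. -/
theorem doubling_index_tendsto_vanishing_order
    (d : ℕ) (hd : 2 ≤ d)
    (u : EuclideanSpace ℝ (Fin d) → ℝ)
    (hu : HarmonicOn u (ball 0 1))
    (hnz : ∃ x ∈ ball (0 : EuclideanSpace ℝ (Fin d)) 1, u x ≠ 0) :
    ∃ k : ℕ, Tendsto (doublingIndex u) (𝓝[>] 0) (𝓝 (k : ℝ)) ∧
      (∀ j : ℕ, j < k → iteratedFDeriv ℝ j u 0 = 0) ∧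
      iteratedFDeriv ℝ k u 0 ≠ 0 := by
  classical
  have hd1 : 1 ≤ d := by omega
  have hA : AnalyticOnNhd ℝ u (ball 0 1) := fun x hx => harmonic_analyticAt hu hx
  have hex := exists_order hA hnz
  set k := Nat.find hex
  have hk : iteratedFDeriv ℝ k u 0 ≠ 0 := Nat.find_spec hex
  have hlt : ∀ j : ℕ, j < k → iteratedFDeriv ℝ j u 0 = 0 := fun j hj => by
    simpa using Nat.find_min hex hj
  refine ⟨k, ?_, hlt, hk⟩
  obtain ⟨p, ρ, hp⟩ := hA 0 (mem_ball_self one_pos)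
  obtain ⟨y, hy1, hy⟩ := diag_sphere hd1 (diag_ne_zero hp hk)
  obtain ⟨C, δ, hδ, hb⟩ := blowup hp hlt
  set P : EuclideanSpace ℝ (Fin d) → ℝ := fun x => p k (fun _ => x)
  have hP : Continuous P := (p k).cont.comp (continuous_pi fun _ => continuous_id)
  have hF := tendsto_F hd1 hA.continuousOn hP (fun t y => diag_smul p k t y) hδ hb
  have hL := integral_pos_of_ne hd1 hP hy1 hy
  set L := ∫ x in sphere (0 : EuclideanSpace ℝ (Fin d)) 1, (P x) ^ 2 ∂μH[((d : ℝ) - 1)]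
  set F := fun r : ℝ => ∫ x in sphere (0 : EuclideanSpace ℝ (Fin d)) 1,
        (u (r • x) / r ^ k) ^ 2 ∂μH[((d : ℝ) - 1)]
  have h2 : Tendsto (fun r : ℝ => 2 * r) (𝓝[>] 0) (𝓝[>] 0) := by
    apply tendsto_nhdsWithin_iff.2
    constructor
    · have : Tendsto (fun r : ℝ => 2 * r) (𝓝 0) (𝓝 (2 * 0)) := by
        apply Continuous.tendsto; fun_prop
      rw [mul_zero] at this
      exact this.mono_left nhdsWithin_le_nhds
    · filter_upwards [self_mem_nhdsWithin] with r hr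
      have : (0:ℝ) < r := hr
      simpa using this
  have hlim : Tendsto (fun r => Real.logb 2 (Real.sqrt ((2 ^ k) ^ 2 * (F (2 * r) / F r))))
      (𝓝[>] 0) (𝓝 (Real.logb 2 (Real.sqrt ((2 ^ k) ^ 2 * (L / L))))) := by
    have h3 := (((hF.comp h2).div hF hL.ne').const_mul (((2:ℝ) ^ k) ^ 2)).sqrt
    refine Filter.Tendsto.logb h3 ?_
    rw [div_self hL.ne', mul_one, Real.sqrt_sq (by positivity)]
    positivity
  have hval : Real.logb 2 (Real.sqrt ((2 ^ k) ^ 2 * (L / L))) = k := by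
    rw [div_self hL.ne', mul_one, Real.sqrt_sq (by positivity), Real.logb_pow]
    simp
  rw [hval] at hlim
  refine hlim.congr' ?_
  have hm : (μH[((d : ℝ) - 1)]).real (sphere (0 : EuclideanSpace ℝ (Fin d)) 1) ≠ 0 := by
    have h3 := sphere_open_pos hd1 hy1 univ_mem
    rw [univ_inter] at h3
    exact (ENNReal.toReal_pos h3.ne' (sphere_finite hd1).ne).ne'
  have hav : ∀ r : ℝ, 0 < r →
      ⨍ x in sphere (0 : EuclideanSpace ℝ (Fin d)) r, (u x) ^ 2 ∂μH[((d : ℝ) - 1)] =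
      ((μH[((d : ℝ) - 1)]).real (sphere (0 : EuclideanSpace ℝ (Fin d)) 1))⁻¹ *
        ((r ^ k) ^ 2 * F r) := by
    intro r hr
    rw [average_sphere_eq hd1 hr, setAverage_eq, smul_eq_mul]
    congr 1
    rw [← integral_const_mul]
    congr 1
    ext x
    have : r ^ k ≠ 0 := by positivity
    field_simp
  filter_upwards [self_mem_nhdsWithin] with r hr
  have hr : (0:ℝ) < r := hr
  unfold doublingIndex
  rw [hav r hr, hav (2 * r) (by positivity)]
  congr 2
  have : r ^ k ≠ 0 := by positivity
  rw [mul_div_mul_left _ _ (inv_ne_zero hm), mul_pow, mul_pow, mul_assoc, mul_div_assoc,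
    mul_div_mul_left _ _ (pow_ne_zero 2 this)]
end
end
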